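/- For every integer k ≥ 2, the fundamental group of the unordered configuration space C_{k+1}^{1,1} (at any basepoint) is isomorphic to the group presented by generators σ_1,…,σ_k subject to the Artin relations among σ_1,…,σ_k and the relation σ_1σ_2⋯σ_{k-1}σ_k²σ_{k-1}⋯σ_2σ_1 = 1. -/

import Mathlib

noncomputable section

open Module Submodule

/-- Topology on the projectivization (quotient topology). -/
instance (K V : Type*) [DivisionRing K] [AddCommGroup V] [Module K V] [TopologicalSpace V] :
    TopologicalSpace (Projectivization K V) :=
  inferInstanceAs (TopologicalSpace (Quotient (projectivizationSetoid K V)))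

/-- The complex projective space `ℂP^n`. -/
abbrev CP (n : ℕ) := Projectivization ℂ (Fin (n + 1) → ℂ)

/-- `Fconf k i n` is the ordered configuration space `F_k^{i,n}` of `k` pairwise distinct
points of `ℂP^n` whose projective span has dimension `i` (i.e. the span of representative
vectors has linear dimension `i + 1`). -/
def Fconf (k i n : ℕ) : Set (Fin k → CP n) :=
  {x | Function.Injective x ∧
    finrank ℂ (span ℂ (Set.range fun j => (x j).rep)) = i + 1}

/-- The equivalence relation on `F_k^{i,n}` identifying tuples differing by a
permutation of the coordinates. -/
def permSetoid (k i n : ℕ) : Setoid (Fconf k i n) where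
  r x y := ∃ σ : Equiv.Perm (Fin k), (y : Fin k → CP n) = (x : Fin k → CP n) ∘ σ
  iseqv := by
    constructor
    · intro x; exact ⟨Equiv.refl _, rfl⟩
    · rintro x y ⟨σ, h⟩
      refine ⟨σ.symm, ?_⟩
      funext i
      simp [h]
    · rintro x y z ⟨σ, h⟩ ⟨τ, h'⟩
      exact ⟨τ.trans σ, by rw [h', h]; rfl⟩

/-- `Cconf k i n` is the unordered configuration space `C_k^{i,n} = F_k^{i,n}/Σ_k`. -/
def Cconf (k i n : ℕ) : Type := Quotient (permSetoid k i n)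

instance (k i n : ℕ) : TopologicalSpace (Cconf k i n) :=
  inferInstanceAs (TopologicalSpace (Quotient (permSetoid k i n)))
/-- The free-group generator `σ_{i+1}` (0-indexed: `σ_i` for `i < k`); junk value `1`
out of range. -/
def br (k i : ℕ) : FreeGroup (Fin k) := if h : i < k then FreeGroup.of ⟨i, h⟩ else 1

/-- The Artin relators among `σ_1, …, σ_k`: `σᵢσⱼ = σⱼσᵢ` for `|i - j| ≥ 2` and
`σᵢσᵢ₊₁σᵢ = σᵢ₊₁σᵢσᵢ₊₁`. -/
def ArtinRels (k : ℕ) : Set (FreeGroup (Fin k)) :=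
  {r | (∃ i j : ℕ, i + 2 ≤ j ∧ j < k ∧ r = br k i * br k j * (br k j * br k i)⁻¹) ∨
       (∃ i : ℕ, i + 1 < k ∧
         r = br k i * br k (i + 1) * br k i * (br k (i + 1) * br k i * br k (i + 1))⁻¹)}

/-- The word `σ_1 σ_2 ⋯ σ_{k-1} σ_k² σ_{k-1} ⋯ σ_2 σ_1` (0-indexed). -/
def sphereWord (k : ℕ) : FreeGroup (Fin k) :=
  ((List.range k).map (br k)).prod * ((List.range k).reverse.map (br k)).prod

/-- The Garside word `Δ_k = σ_1(σ_2σ_1)(σ_3σ_2σ_1)⋯(σ_{k-1}⋯σ_2σ_1)` (0-indexed). -/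
def DeltaWord (k : ℕ) : FreeGroup (Fin k) :=
  ((List.range k).map fun m => ((List.range m).reverse.map (br k)).prod).prod

section

open Set Topology unitInterval

/-- A cover of a space by simply connected open sets sharing a base point. -/
structure PointedCover (X ι : Type*) [TopologicalSpace X] where
  carrier : ι → Set X
  isOpen_carrier : ∀ i, IsOpen (carrier i)
  simplyConnected : ∀ i, SimplyConnectedSpace (carrier i)
  base : X
  base_mem : ∀ i, base ∈ carrier i
  exists_mem : ∀ x, ∃ i, x ∈ carrier i

namespace PointedCover

variable {X ι : Type*} [TopologicalSpace X] (C : PointedCover X ι)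

/-- The homotopy class of the paths from the base point to `x` inside the set `C.carrier i`. -/
def ray (i : ι) {x : X} (hx : x ∈ C.carrier i) : Path.Homotopic.Quotient C.base x :=
  have := C.simplyConnected i
  (Path.Homotopic.Quotient.mk (PathConnectedSpace.somePath (⟨C.base, C.base_mem i⟩ : C.carrier i)
    ⟨x, hx⟩)).map ⟨Subtype.val, continuous_subtype_val⟩

theorem mk_eq_mk {i : ι} {x y : X} (γ γ' : Path x y) (h : ∀ t, γ t ∈ C.carrier i)
    (h' : ∀ t, γ' t ∈ C.carrier i) :
    Path.Homotopic.Quotient.mk γ = Path.Homotopic.Quotient.mk γ' := by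
  have := C.simplyConnected i
  have hx : x ∈ C.carrier i := by simpa using h 0
  have hy : y ∈ C.carrier i := by simpa using h 1
  let lift (γ : Path x y) (h : ∀ t, γ t ∈ C.carrier i) :
      Path (⟨x, hx⟩ : C.carrier i) ⟨y, hy⟩ :=
    { toFun := fun t => ⟨γ t, h t⟩
      continuous_toFun := by fun_prop
      source' := by simp
      target' := by simp }
  exact Path.Homotopic.Quotient.eq.2
    ((SimplyConnectedSpace.paths_homotopic (lift γ h) (lift γ' h')).map
      ⟨Subtype.val, continuous_subtype_val⟩)

theorem exists_ray_eq_mk (i : ι) {x : X} (hx : x ∈ C.carrier i) :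
    ∃ γ : Path C.base x, (∀ t, γ t ∈ C.carrier i) ∧ C.ray i hx = .mk γ := by
  have := C.simplyConnected i
  exact ⟨(PathConnectedSpace.somePath (⟨C.base, C.base_mem i⟩ : C.carrier i)
    ⟨x, hx⟩).map continuous_subtype_val, fun t => Subtype.coe_prop _, rfl⟩

theorem ray_trans {i : ι} {x y : X} (hx : x ∈ C.carrier i) (hy : y ∈ C.carrier i)
    (γ : Path x y) (h : ∀ t, γ t ∈ C.carrier i) :
    (C.ray i hx).trans (.mk γ) = C.ray i hy := by
  obtain ⟨δ, hδ, e⟩ := C.exists_ray_eq_mk i hx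
  obtain ⟨δ', hδ', e'⟩ := C.exists_ray_eq_mk i hy
  rw [e, e', ← Path.Homotopic.Quotient.mk_trans]
  refine C.mk_eq_mk _ _ (fun t => ?_) hδ'
  have : δ.trans γ t ∈ range (δ.trans γ) := mem_range_self t
  rw [Path.trans_range] at this
  rcases this with ⟨s, hs⟩ | ⟨s, hs⟩
  exacts [hs ▸ hδ s, hs ▸ h s]

theorem ray_base (i : ι) : C.ray i (C.base_mem i) = .refl C.base := by
  obtain ⟨δ, hδ, e⟩ := C.exists_ray_eq_mk i (C.base_mem i)
  rw [e, ← Path.Homotopic.Quotient.mk_refl]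
  exact C.mk_eq_mk _ _ hδ fun _ => C.base_mem i

/-- The loop leaving the base point through `C.carrier j` and returning through `C.carrier i`. -/
def loop (i j : ι) {x : X} (hi : x ∈ C.carrier i) (hj : x ∈ C.carrier j) :
    FundamentalGroup X C.base :=
  (C.ray j hj).trans (C.ray i hi).symm

theorem loop_mul_loop {i j k : ι} {x : X} (hi : x ∈ C.carrier i) (hj : x ∈ C.carrier j)
    (hk : x ∈ C.carrier k) : C.loop i j hi hj * C.loop j k hj hk = C.loop i k hi hk := by
  rw [FundamentalGroup.mul_def]
  unfold loop
  rw [Path.Homotopic.Quotient.trans_assoc,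
    ← Path.Homotopic.Quotient.trans_assoc _ _ (C.ray i hi).symm,
    Path.Homotopic.Quotient.symm_trans, Path.Homotopic.Quotient.refl_trans]

theorem loop_self {i : ι} {x : X} (hi : x ∈ C.carrier i) : C.loop i i hi hi = 1 :=
  Path.Homotopic.Quotient.trans_symm _

theorem loop_inv {i j : ι} {x : X} (hi : x ∈ C.carrier i) (hj : x ∈ C.carrier j) :
    (C.loop i j hi hj)⁻¹ = C.loop j i hj hi :=
  inv_eq_of_mul_eq_one_left ((C.loop_mul_loop hj hi hj).trans (C.loop_self hj))

theorem loop_base (i j : ι) : C.loop i j (C.base_mem i) (C.base_mem j) = 1 := by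
  rw [loop, ray_base, ray_base]
  exact Path.Homotopic.Quotient.trans_symm _

theorem loop_eq_of_path {i j : ι} {x y : X} (γ : Path x y) (hi : ∀ t, γ t ∈ C.carrier i)
    (hj : ∀ t, γ t ∈ C.carrier j) (hxi : x ∈ C.carrier i) (hxj : x ∈ C.carrier j)
    (hyi : y ∈ C.carrier i) (hyj : y ∈ C.carrier j) :
    C.loop i j hxi hxj = C.loop i j hyi hyj := by
  have ei := C.ray_trans hxi hyi γ hi
  have ej := C.ray_trans hxj hyj γ hj
  have key : (C.ray j hyj) = ((C.ray j hxj).trans (C.ray i hxi).symm).trans (C.ray i hyi) := by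
    rw [← ei, ← ej, Path.Homotopic.Quotient.trans_assoc,
      ← Path.Homotopic.Quotient.trans_assoc _ _ (Path.Homotopic.Quotient.mk γ),
      Path.Homotopic.Quotient.symm_trans, Path.Homotopic.Quotient.refl_trans]
  unfold loop
  rw [key, Path.Homotopic.Quotient.trans_assoc, Path.Homotopic.Quotient.trans_symm,
    Path.Homotopic.Quotient.trans_refl]

theorem loop_eq_of_joinedIn {i j : ι} {x y : X}
    (h : JoinedIn (C.carrier i ∩ C.carrier j) x y) (hxi : x ∈ C.carrier i)
    (hxj : x ∈ C.carrier j) (hyi : y ∈ C.carrier i) (hyj : y ∈ C.carrier j) :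
    C.loop i j hxi hxj = C.loop i j hyi hyj := by
  obtain ⟨γ, hγ⟩ := h
  exact C.loop_eq_of_path γ (fun t => (hγ t).1) (fun t => (hγ t).2) _ _ _ _

instance : LocallyPathConnectedSpace I :=
  (isQuotientMap_projIcc (h := zero_le_one' ℝ)).locallyPathConnectedSpace

instance : ContractibleSpace I :=
  (convex_Icc (0 : ℝ) 1).contractibleSpace ⟨0, unitInterval.zero_mem⟩

theorem eventually_joinedIn {x y : X} (γ : Path x y) {O : Set X} (hO : IsOpen O) {t : I}
    (ht : γ t ∈ O) : ∀ᶠ s in 𝓝 t, JoinedIn (γ ⁻¹' O) t s :=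
  have h : γ ⁻¹' O ∈ 𝓝 t := (hO.preimage γ.continuous).mem_nhds ht
  pathComponentIn_mem_nhds h

theorem loop_mem_of_path (H : Subgroup (FundamentalGroup X C.base)) (J : Set ι) (j : ι)
    (hJ : ∀ i ∈ J, ∀ i' ∈ J, ∀ x (hi : x ∈ C.carrier i) (hi' : x ∈ C.carrier i'),
      C.loop i i' hi hi' ∈ H)
    {x y : X} (γ : Path x y) (hj : ∀ t, γ t ∈ C.carrier j)
    (hγ : ∀ t, ∃ i ∈ J, γ t ∈ C.carrier i)
    {i i' : ι} (hiJ : i ∈ J) (hiJ' : i' ∈ J) (hxj : x ∈ C.carrier j) (hxi : x ∈ C.carrier i)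
    (hyj : y ∈ C.carrier j) (hyi : y ∈ C.carrier i') (h : C.loop j i hxj hxi ∈ H) :
    C.loop j i' hyj hyi ∈ H := by
  let F : I → Prop := fun t => ∃ i ∈ J, ∃ hi : γ t ∈ C.carrier i, C.loop j i (hj t) hi ∈ H
  have hF : IsLocallyConstant F := by
    rw [IsLocallyConstant.iff_eventually_eq]
    intro t
    obtain ⟨a, haJ, ha⟩ := hγ t
    filter_upwards [eventually_joinedIn γ ((C.isOpen_carrier j).inter (C.isOpen_carrier a))
      ⟨hj t, ha⟩] with s hs
    have hsa : γ s ∈ C.carrier a := hs.target_mem.2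
    have key := C.loop_eq_of_joinedIn (hs.map_continuousOn γ.continuous.continuousOn |>.mono
      (image_preimage_subset _ _)) (hj t) ha (hj s) hsa
    have iff (u : I) (hu : γ u ∈ C.carrier a) : F u ↔ C.loop j a (hj u) hu ∈ H := by
      refine ⟨fun ⟨b, hbJ, hb, hm⟩ => ?_, fun hm => ⟨a, haJ, hu, hm⟩⟩
      rw [← C.loop_mul_loop (hj u) hb hu]
      exact H.mul_mem hm (hJ _ hbJ _ haJ _ _ _)
    rw [eq_iff_iff, iff s hsa, iff t ha, key]
  have h0 : F 0 := by
    refine ⟨i, hiJ, by simpa using hxi, ?_⟩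
    convert h using 2
    simp
  rw [hF.apply_eq_of_preconnectedSpace 0 1] at h0
  obtain ⟨b, hbJ, hb, hm⟩ := h0
  have hb' : y ∈ C.carrier b := by simpa using hb
  have hm' : C.loop j b hyj hb' ∈ H := by
    convert hm using 2
    simp
  rw [← C.loop_mul_loop hyj hb' hyi]
  exact H.mul_mem hm' (hJ _ hbJ _ hiJ' _ _ _)

theorem eq_top_of_loop_mem (H : Subgroup (FundamentalGroup X C.base))
    (hH : ∀ i j x (hi : x ∈ C.carrier i) (hj : x ∈ C.carrier j), C.loop i j hi hj ∈ H) :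
    H = ⊤ := by
  rw [eq_top_iff]
  rintro g -
  obtain ⟨γ, rfl⟩ := Path.Homotopic.Quotient.mk_surjective g
  let q (t : I) : Path.Homotopic.Quotient (γ 0) (γ t) :=
    (Path.Homotopic.Quotient.mk (PathConnectedSpace.somePath 0 t)).map γ.toContinuousMap
  let p (t : I) : Path.Homotopic.Quotient C.base (γ t) := (q t).cast γ.source.symm rfl
  let B (i : ι) (t : I) (hi : γ t ∈ C.carrier i) : FundamentalGroup X C.base :=
    (p t).trans (C.ray i hi).symm
  have hp (s t : I) (δ : Path s t) : (p s).trans (.mk (δ.map γ.continuous)) = p t := by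
    have : (Path.Homotopic.Quotient.mk (PathConnectedSpace.somePath 0 s)).trans (.mk δ) =
      .mk (PathConnectedSpace.somePath 0 t) := Subsingleton.elim _ _
    have h2 : (q s).trans (.mk (δ.map γ.continuous)) = q t := by
      simp only [q]
      rw [← this, ← Path.Homotopic.Quotient.mk_trans, ← Path.Homotopic.Quotient.mk_map,
        ← Path.Homotopic.Quotient.mk_map, ← Path.Homotopic.Quotient.mk_trans, Path.map_trans]
    have h3 : ∀ {a b c d : X} (h : d = a) (u : Path.Homotopic.Quotient a b)
      (v : Path.Homotopic.Quotient b c), (u.cast h rfl).trans v = (u.trans v).cast h rfl := by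
      rintro a b c d rfl u v
      simp
    simp only [p]
    rw [h3, h2]
  have hB (i j : ι) (t : I) (hi : γ t ∈ C.carrier i) (hj : γ t ∈ C.carrier j) :
      B i t hi = C.loop i j hi hj * B j t hj := by
    rw [FundamentalGroup.mul_def]
    simp only [B, loop]
    rw [Path.Homotopic.Quotient.trans_assoc,
      ← Path.Homotopic.Quotient.trans_assoc _ _ (C.ray i hi).symm,
      Path.Homotopic.Quotient.symm_trans, Path.Homotopic.Quotient.refl_trans]
  let F : I → Prop := fun t => ∃ i, ∃ hi : γ t ∈ C.carrier i, B i t hi ∈ H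
  have hF : IsLocallyConstant F := by
    rw [IsLocallyConstant.iff_eventually_eq]
    intro t
    obtain ⟨a, ha⟩ := C.exists_mem (γ t)
    filter_upwards [eventually_joinedIn γ (C.isOpen_carrier a) ha] with s hs
    have hsa : γ s ∈ C.carrier a := hs.target_mem
    have key : B a t ha = B a s hsa := by
      obtain ⟨δ, hδ⟩ := hs
      simp only [B]
      rw [← hp t s δ, ← C.ray_trans ha hsa (δ.map γ.continuous) (fun u => hδ u)]
      generalize C.ray a ha = r
      generalize p t = r'
      generalize Path.Homotopic.Quotient.mk (δ.map γ.continuous) = d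
      have : (r.trans d).symm = d.symm.trans r.symm := by
        induction r using Path.Homotopic.Quotient.ind with | mk r
        induction d using Path.Homotopic.Quotient.ind with | mk d
        rw [← Path.Homotopic.Quotient.mk_trans, ← Path.Homotopic.Quotient.mk_symm, Path.trans_symm]
        rfl
      rw [this, Path.Homotopic.Quotient.trans_assoc,
        ← Path.Homotopic.Quotient.trans_assoc d, Path.Homotopic.Quotient.trans_symm,
        Path.Homotopic.Quotient.refl_trans]
    have iff (u : I) (hu : γ u ∈ C.carrier a) : F u ↔ B a u hu ∈ H := by
      refine ⟨fun ⟨b, hb, hm⟩ => ?_, fun hm => ⟨a, hu, hm⟩⟩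
      rw [hB a b u hu hb]
      exact H.mul_mem (hH _ _ _ _ _) hm
    rw [eq_iff_iff, iff s hsa, iff t ha, key]
  have cast_mem {x : X} (hx : x = C.base) (i : ι) (hi : x ∈ C.carrier i)
      (r : Path.Homotopic.Quotient C.base x) :
      r.trans (C.ray i hi).symm = r.cast rfl hx.symm := by
    subst hx
    rw [ray_base]
    have h : (Path.Homotopic.Quotient.refl C.base).symm = .refl C.base := by
      rw [← Path.Homotopic.Quotient.mk_refl, ← Path.Homotopic.Quotient.mk_symm, Path.refl_symm]
    rw [h, Path.Homotopic.Quotient.trans_refl, Path.Homotopic.Quotient.cast_rfl_rfl]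
  have cast_trans {a b : X} (h : b = a) :
      ((Path.Homotopic.Quotient.refl a).cast h rfl).cast rfl h = .refl b := by
    subst h
    simp
  have h0 : F 0 := by
    obtain ⟨a, ha⟩ := C.exists_mem (γ 0)
    refine ⟨a, ha, ?_⟩
    have : B a 0 ha = 1 := by
      simp only [B, p]
      rw [cast_mem γ.source]
      have : q 0 = .refl _ := by
        have : Path.Homotopic.Quotient.mk (PathConnectedSpace.somePath (0 : I) 0) = .refl 0 :=
          Subsingleton.elim _ _
        simp only [q]
        rw [this]
        rfl
      rw [this]
      exact cast_trans _
    rw [this]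
    exact H.one_mem
  rw [hF.apply_eq_of_preconnectedSpace 0 1] at h0
  obtain ⟨a, ha, hm⟩ := h0
  have : B a 1 ha = Path.Homotopic.Quotient.mk γ := by
    simp only [B, p]
    rw [cast_mem γ.target]
    let idp : Path (0 : I) 1 := ⟨ContinuousMap.id I, rfl, rfl⟩
    have : Path.Homotopic.Quotient.mk (PathConnectedSpace.somePath (0 : I) 1) = .mk idp :=
      Subsingleton.elim _ _
    simp only [q]
    rw [this]
    rfl
  rwa [this] at hm

/-- The principal covering glued from a locally constant cocycle. -/
def bundleCore {G : Type*} [Group G] [TopologicalSpace G] [DiscreteTopology G] (g : ι → ι → X → G)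
    (hloc : ∀ i j, ∀ x ∈ C.carrier i ∩ C.carrier j, ∀ᶠ y in 𝓝 x, g i j y = g i j x)
    (hmul : ∀ i j k, ∀ x, x ∈ C.carrier i → x ∈ C.carrier j → x ∈ C.carrier k →
      g i j x * g j k x = g i k x) : FiberBundleCore ι X G where
  baseSet := C.carrier
  isOpen_baseSet := C.isOpen_carrier
  indexAt x := (C.exists_mem x).choose
  mem_baseSet_at x := (C.exists_mem x).choose_spec
  coordChange i j x v := g j i x * v
  coordChange_self i x hx v := by
    have h : g i i x = 1 := mul_eq_left.1 (hmul i i i x hx hx hx)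
    rw [h, one_mul]
  continuousOn_coordChange i j := by
    rintro ⟨x, v⟩ ⟨⟨hi, hj⟩, -⟩
    apply ContinuousAt.continuousWithinAt
    have h1 : (fun p : X × G => g j i p.1 * p.2) =ᶠ[𝓝 (x, v)] fun p => g j i x * p.2 := by
      have := (continuous_fst (X := X) (Y := G)).continuousAt (x := (x, v)) |>.eventually
        (hloc j i x ⟨hj, hi⟩)
      filter_upwards [this] with p hp
      rw [hp]
    refine ContinuousAt.congr ?_ h1.symm
    exact (continuous_of_discreteTopology (f := fun w : G => g j i x * w)).continuousAt.comp
      continuous_snd.continuousAt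
  coordChange_comp i j k := by
    rintro x ⟨⟨hi, hj⟩, hk⟩ v
    rw [← mul_assoc, hmul k j i x hk hj hi]

/-- A locally constant cocycle that is trivial at the base point is realized by an action of the
fundamental group. -/
theorem exists_monodromy.{u, v, w} {X : Type u} {ι : Type v} [TopologicalSpace X]
    (C : PointedCover X ι) {G : Type w} [Group G] (g : ι → ι → X → G)
    (hloc : ∀ i j, ∀ x ∈ C.carrier i ∩ C.carrier j, ∀ᶠ y in 𝓝 x, g i j y = g i j x)
    (hmul : ∀ i j k, ∀ x, x ∈ C.carrier i → x ∈ C.carrier j → x ∈ C.carrier k →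
      g i j x * g j k x = g i k x) (hbase : ∀ i j, g i j C.base = 1) :
    ∃ (E : Type (max u w)) (T : FundamentalGroup X C.base →* Equiv.Perm E) (e : G → E),
      Function.Injective e ∧ ∀ i j x (hi : x ∈ C.carrier i) (hj : x ∈ C.carrier j) (h : G),
        T (C.loop i j hi hj) (e h) = e (g i j x * h) := by
  let _ : TopologicalSpace G := ⊥
  have : DiscreteTopology G := ⟨rfl⟩
  let Z := C.bundleCore g hloc hmul
  have cov : IsCoveringMap (Bundle.TotalSpace.proj : Bundle.TotalSpace G Z.Fiber → X) :=
    FiberBundle.isCoveringMap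
  let pt (i : ι) (x : X) (v : G) : (Bundle.TotalSpace.proj : Bundle.TotalSpace G Z.Fiber → X) ⁻¹'
    {x} := ⟨⟨x, g (Z.indexAt x) i x * v⟩, rfl⟩
  have pt_eq (i j : ι) (x : X) (hi : x ∈ C.carrier i) (hj : x ∈ C.carrier j) (v : G) :
      pt j x v = pt i x (g i j x * v) := by
    simp only [pt]
    rw [← mul_assoc, hmul _ i j x (Z.mem_baseSet_at x) hi hj]
  have pt_base (i : ι) (v : G) : (pt i C.base v).1 = ⟨C.base, v⟩ := by
    simp only [pt]
    rw [hbase, one_mul]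
  have lift (i : ι) {x y : X} (γ : Path x y) (hγ : ∀ t, γ t ∈ C.carrier i) (v : G) :
      cov.monodromy (.mk γ) (pt i x v) = pt i y v := by
    let Γ : Path (pt i x v).1 (pt i y v).1 :=
      { toFun := fun t => (pt i (γ t) v).1
        continuous_toFun := by
          have h := (Z.localTriv i).toOpenPartialHomeomorph.symm.continuousOn.comp_continuous
            (f := fun t => (γ t, v)) (by fun_prop) (fun t => by
              exact (Z.mem_localTriv_target i _).2 (hγ t))
          exact h
        source' := by rw [γ.source]
        target' := by rw [γ.target] }
    exact cov.monodromy_eq_of_map_eq (.mk Γ) rfl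
  have symm_lift (i : ι) {x : X} (hi : x ∈ C.carrier i) (v : G) :
      cov.monodromy (C.ray i hi).symm (pt i x v) = pt i C.base v := by
    obtain ⟨δ, hδ, e⟩ := C.exists_ray_eq_mk i hi
    rw [e, ← Path.Homotopic.Quotient.mk_symm]
    exact lift i δ.symm (fun t => hδ _) v
  have ray_lift (i : ι) {x : X} (hi : x ∈ C.carrier i) (v : G) :
      cov.monodromy (C.ray i hi) (pt i C.base v) = pt i x v := by
    obtain ⟨δ, hδ, e⟩ := C.exists_ray_eq_mk i hi
    rw [e]
    exact lift i _ hδ v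
  refine ⟨_, cov.monodromyPerm C.base, fun v => pt (C.exists_mem C.base).choose C.base v, ?_, ?_⟩
  · intro v w h
    have := congrArg Subtype.val h
    simp only [pt_base] at this
    exact eq_of_heq (Bundle.TotalSpace.mk.inj this).2
  · intro i j x hi hj h
    rw [IsCoveringMap.coe_monodromyPerm, loop, cov.monodromy_trans_apply]
    have a (i j : ι) (v : G) : pt i C.base v = pt j C.base v := Subtype.ext <| by
      rw [pt_base, pt_base]
    beta_reduce
    rw [a _ j, ray_lift, pt_eq i j x hi hj, symm_lift]
    exact a _ _ _

end PointedCover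

end

section

/-- The adjacent transposition exchanging `i` and `i + 1`. -/
def adjSwap {k : ℕ} (i : Fin k) : Equiv.Perm (Fin (k + 1)) := Equiv.swap i.castSucc i.succ

namespace ArtinLift

variable {k : ℕ} {Γ : Type*} [Group Γ]

open Equiv

theorem adjSwap_castSucc (i : Fin k) : adjSwap i i.castSucc = i.succ := swap_apply_left _ _

theorem adjSwap_succ (i : Fin k) : adjSwap i i.succ = i.castSucc := swap_apply_right _ _

theorem adjSwap_of_ne (i : Fin k) {a : Fin (k + 1)} (h : (a : ℕ) ≠ i) (h' : (a : ℕ) ≠ i + 1) :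
    adjSwap i a = a :=
  swap_apply_of_ne_of_ne (fun e => h (by simp [e])) (fun e => h' (by simp [e]))

theorem adjSwap_mul_self (i : Fin k) : adjSwap i * adjSwap i = 1 := swap_mul_self _ _

theorem adjSwap_adjSwap (i : Fin k) (a : Fin (k + 1)) : adjSwap i (adjSwap i a) = a :=
  swap_apply_self _ _ _

theorem val_adjSwap (i : Fin k) (a : Fin (k + 1)) :
    (adjSwap i a : ℕ) =
      if (a : ℕ) = i then (i : ℕ) + 1 else if (a : ℕ) = i + 1 then (i : ℕ) else a := by
  unfold adjSwap
  rw [swap_apply_def]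
  simp only [Fin.ext_iff, Fin.val_castSucc, Fin.val_succ]
  split_ifs <;> simp

theorem adjSwap_lt_adjSwap (i : Fin k) {a b : Fin (k + 1)} (h : a < b)
    (h' : ¬ (a = i.castSucc ∧ b = i.succ)) : adjSwap i a < adjSwap i b := by
  simp only [Fin.lt_def, Fin.ext_iff, val_adjSwap, Fin.val_castSucc, Fin.val_succ] at *
  split_ifs <;> omega

/-- A family satisfying the Artin relations. -/
structure IsArtin (σ : Fin k → Γ) : Prop where
  comm : ∀ i j : Fin k, (i : ℕ) + 2 ≤ j → σ i * σ j = σ j * σ i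
  braid : ∀ i j : Fin k, (i : ℕ) + 1 = j → σ i * σ j * σ i = σ j * σ i * σ j

/-- A set-theoretic lift of permutations which is multiplicative along reduced expressions. -/
structure IsLift (σ : Fin k → Γ) (L : Perm (Fin (k + 1)) → Γ) : Prop where
  one : L 1 = 1
  mul_adjSwap : ∀ w i, w i.castSucc < w i.succ → L (w * adjSwap i) = L w * σ i

theorem eq_one_of_strictMono {w : Perm (Fin (k + 1))} (hm : StrictMono w) : w = 1 := by
  have : hm.orderIsoOfSurjective w w.surjective = OrderIso.refl _ := Subsingleton.elim _ _
  ext a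
  simpa using congrArg (fun f => (f a : ℕ)) this

theorem exists_descent {w : Perm (Fin (k + 1))} (hw : w ≠ 1) :
    ∃ i : Fin k, w i.succ < w i.castSucc := by
  by_contra! h
  have hm : StrictMono w := Fin.strictMono_iff_lt_succ.2 fun i =>
    lt_of_le_of_ne (h i) fun e => by simpa [Fin.ext_iff] using w.injective e
  exact hw (eq_one_of_strictMono hm)

/-- A measure of the length of a permutation. -/
def height (w : Perm (Fin (k + 1))) : ℕ := ∑ a : Fin (k + 1), a * (w a).rev

theorem height_mul_adjSwap_lt {w : Perm (Fin (k + 1))} {i : Fin k} (h : w i.succ < w i.castSucc) :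
    height (w * adjSwap i) < height w := by
  have e : height (w * adjSwap i) = ∑ a : Fin (k + 1), (adjSwap i a : ℕ) * (w a).rev := by
    unfold height
    rw [← Equiv.sum_comp (adjSwap i)]
    simp [adjSwap_adjSwap]
  have d : ∑ a : Fin (k + 1), (((adjSwap i a : ℕ) : ℤ) - (a : ℕ)) * ((w a).rev : ℕ) < 0 := by
    rw [Finset.sum_eq_add i.castSucc i.succ (by simp [Fin.ext_iff])]
    · rw [adjSwap_castSucc, adjSwap_succ]
      simp only [Fin.lt_def, Fin.val_rev, Fin.val_castSucc, Fin.val_succ] at *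
      have := (w i.castSucc).is_lt
      push_cast
      rw [Nat.cast_sub (by omega), Nat.cast_sub (by omega)]
      linarith [(Nat.cast_lt (α := ℤ)).2 h]
    · rintro a - ⟨h1, h2⟩
      rw [adjSwap_of_ne]
      · simp
      · simpa [Fin.ext_iff] using h1
      · simpa [Fin.ext_iff] using h2
    · simp
    · simp
  rw [e]
  unfold height
  zify
  simp only [sub_mul, Finset.sum_sub_distrib] at d
  linarith

/-- `Reach σ w g` holds when `g` is the product of the generators along some reduced expression
of `w`. -/
inductive Reach (σ : Fin k → Γ) : Perm (Fin (k + 1)) → Γ → Prop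
  | one : Reach σ 1 1
  | mul {w g} (i : Fin k) (h : w i.castSucc < w i.succ) (hr : Reach σ w g) :
      Reach σ (w * adjSwap i) (g * σ i)

theorem Reach.of_descent {σ : Fin k → Γ} {w : Perm (Fin (k + 1))} {i : Fin k}
    (h : w i.succ < w i.castSucc) {g : Γ} (hr : Reach σ (w * adjSwap i) g) :
    Reach σ w (g * σ i) := by
  have := Reach.mul i (by simpa [adjSwap_castSucc, adjSwap_succ] using h) hr
  rwa [mul_assoc, adjSwap_mul_self, mul_one] at this

theorem Reach.cases_descent {σ : Fin k → Γ} {w : Perm (Fin (k + 1))} {g : Γ} (hr : Reach σ w g) :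
    (w = 1 ∧ g = 1) ∨ ∃ i g', w i.succ < w i.castSucc ∧ Reach σ (w * adjSwap i) g' ∧
      g = g' * σ i := by
  cases hr with
  | one => exact .inl ⟨rfl, rfl⟩
  | @mul w g i h hr =>
    refine .inr ⟨i, g, ?_, ?_, rfl⟩
    · simpa [adjSwap_castSucc, adjSwap_succ] using h
    · rwa [mul_assoc, adjSwap_mul_self, mul_one]

theorem exists_reach (σ : Fin k → Γ) (w : Perm (Fin (k + 1))) : ∃ g, Reach σ w g := by
  induction hm : height w using Nat.strong_induction_on generalizing w with
  | _ m ih =>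
    by_cases hw : w = 1
    · exact ⟨1, hw ▸ .one⟩
    · obtain ⟨i, hi⟩ := exists_descent hw
      obtain ⟨g, hg⟩ := ih _ (hm ▸ height_mul_adjSwap_lt hi) _ rfl
      exact ⟨_, hg.of_descent hi⟩

theorem adjSwap_comm {i j : Fin k} (h : (i : ℕ) + 2 ≤ j) :
    adjSwap i * adjSwap j = adjSwap j * adjSwap i := by
  ext a
  simp only [Perm.mul_apply, val_adjSwap]
  split_ifs <;> omega

theorem adjSwap_braid {i j : Fin k} (h : (i : ℕ) + 1 = j) :
    adjSwap i * adjSwap j * adjSwap i = adjSwap j * adjSwap i * adjSwap j := by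
  unfold adjSwap
  rw [show i.succ = j.castSucc from Fin.ext (by simpa using h),
    swap_mul_swap_mul_swap (by simp [Fin.ext_iff]; omega) (by simp [Fin.ext_iff]; omega),
    swap_comm i.castSucc j.castSucc, swap_comm j.castSucc j.succ,
    swap_mul_swap_mul_swap (by simp [Fin.ext_iff]) (by simp [Fin.ext_iff]; omega), swap_comm]

theorem Reach.unique {σ : Fin k → Γ} (hσ : IsArtin σ) {w : Perm (Fin (k + 1))} {g g' : Γ}
    (h : Reach σ w g) (h' : Reach σ w g') : g = g' := by
  induction hm : height w using Nat.strong_induction_on generalizing w g g' with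
  | _ m ih =>
    subst hm
    rcases h.cases_descent with ⟨rfl, rfl⟩ | ⟨i, g, hi, hg, rfl⟩
    · rcases h'.cases_descent with ⟨-, rfl⟩ | ⟨i, g, hi, -⟩
      · rfl
      · simp [Fin.lt_def] at hi
    rcases h'.cases_descent with ⟨rfl, rfl⟩ | ⟨j, g', hj, hg', rfl⟩
    · simp [Fin.lt_def] at hi
    have ei := fun u v => @ih _ (height_mul_adjSwap_lt hi) (w * adjSwap i) u v
    have ej := fun u v => @ih _ (height_mul_adjSwap_lt hj) (w * adjSwap j) u v
    wlog hij : (i : ℕ) ≤ j generalizing i j g g'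
    · exact (this j g' hj hg' h' i g hi hg h ej ei (by omega)).symm
    rcases (show (i : ℕ) = j ∨ (i : ℕ) + 2 ≤ j ∨ (i : ℕ) + 1 = j by omega) with e | e | e
    · obtain rfl : i = j := Fin.ext e
      rw [ei _ _ hg hg' rfl]
    · obtain ⟨r, hr⟩ := exists_reach σ (w * adjSwap i * adjSwap j)
      have hr' := hr
      rw [mul_assoc, adjSwap_comm e, ← mul_assoc] at hr'
      have h1 := ei _ _ hg (hr.of_descent (by
        simp only [Perm.mul_apply]
        rwa [adjSwap_of_ne, adjSwap_of_ne] <;> simp <;> omega)) rfl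
      have h2 := ej _ _ hg' (hr'.of_descent (by
        simp only [Perm.mul_apply]
        rwa [adjSwap_of_ne, adjSwap_of_ne] <;> simp <;> omega)) rfl
      rw [h1, h2, mul_assoc, mul_assoc, hσ.comm i j e]
    · have eq : i.succ = j.castSucc := Fin.ext (by simpa using e)
      have vi : adjSwap i j.succ = j.succ := adjSwap_of_ne _ (by simp; omega) (by simp; omega)
      have vj : adjSwap j i.castSucc = i.castSucc :=
        adjSwap_of_ne _ (by simp; omega) (by simp; omega)
      have vi' : adjSwap i j.castSucc = i.castSucc := by rw [← eq, adjSwap_succ]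
      have vj' : adjSwap j i.succ = j.succ := by rw [eq, adjSwap_castSucc]
      obtain ⟨r, hr⟩ := exists_reach σ (w * adjSwap i * adjSwap j * adjSwap i)
      have hr' := hr
      rw [mul_assoc w, mul_assoc w, adjSwap_braid e, ← mul_assoc, ← mul_assoc] at hr'
      rw [eq] at hi
      have h1 := ei _ _ hg ((hr.of_descent (by
        simpa [Perm.mul_apply, vi, vj, vi', vj', adjSwap_castSucc, ← eq] using hj)).of_descent (by
        simpa [Perm.mul_apply, vi, vj, vi', vj', adjSwap_castSucc] using hj.trans hi)) rfl
      have h2 := ej _ _ hg' ((hr'.of_descent (by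
        simpa [Perm.mul_apply, vi, vj, vi', vj', adjSwap_castSucc, adjSwap_succ] using
          hi)).of_descent (by
        simpa [Perm.mul_apply, vi, vj, vi', vj', adjSwap_castSucc] using hj.trans hi)) rfl
      rw [h1, h2]
      have := hσ.braid i j e
      rw [mul_assoc, mul_assoc, mul_assoc, mul_assoc, ← mul_assoc (σ i), this, mul_assoc (σ j)]

theorem exists_isLift {σ : Fin k → Γ} (hσ : IsArtin σ) : ∃ L, IsLift σ L := by
  choose L hL using exists_reach σ
  exact ⟨L, (hL 1).unique hσ .one, fun w i h => (hL _).unique hσ (.mul i h (hL w))⟩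

namespace IsLift

variable {σ : Fin k → Γ} {L : Perm (Fin (k + 1)) → Γ}

theorem apply_of_descent (hL : IsLift σ L) {w : Perm (Fin (k + 1))} {i : Fin k}
    (h : w i.succ < w i.castSucc) : L w = L (w * adjSwap i) * σ i := by
  rw [← hL.mul_adjSwap _ _ (by simpa [adjSwap_castSucc, adjSwap_succ] using h), mul_assoc,
    adjSwap_mul_self, mul_one]

theorem unique {L' : Perm (Fin (k + 1)) → Γ} (hL : IsLift σ L) (hL' : IsLift σ L') : L = L' := by
  ext w
  induction hm : height w using Nat.strong_induction_on generalizing w with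
  | _ m ih =>
    by_cases hw : w = 1
    · rw [hw, hL.one, hL'.one]
    · obtain ⟨i, hi⟩ := exists_descent hw
      rw [hL.apply_of_descent hi, hL'.apply_of_descent hi,
        ih _ (hm ▸ height_mul_adjSwap_lt hi) _ rfl]

theorem map {Γ' : Type*} [Group Γ'] (hL : IsLift σ L) (φ : Γ →* Γ') :
    IsLift (fun i => φ (σ i)) (fun w => φ (L w)) :=
  ⟨by rw [hL.one, map_one], fun w i h => by rw [hL.mul_adjSwap w i h, map_mul]⟩

theorem apply_adjSwap (hL : IsLift σ L) (i : Fin k) : L (adjSwap i) = σ i := by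
  have := hL.mul_adjSwap 1 i (by simp [Fin.lt_def])
  rwa [one_mul, hL.one, one_mul] at this

theorem mul (hL : IsLift σ L) (u v : Perm (Fin (k + 1)))
    (h : ∀ a b, a < b → v b < v a → u (v b) < u (v a)) : L (u * v) = L u * L v := by
  induction hm : height v using Nat.strong_induction_on generalizing v with
  | _ m ih =>
    by_cases hv : v = 1
    · rw [hv, mul_one, hL.one, mul_one]
    · obtain ⟨i, hi⟩ := exists_descent hv
      rw [hL.apply_of_descent hi, hL.apply_of_descent (w := u * v) (i := i)
        (h _ _ (by simp [Fin.lt_def]) hi), mul_assoc u,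
        ih _ (hm ▸ height_mul_adjSwap_lt hi) _ ?_ rfl, mul_assoc]
      intro a b hab hlt
      refine h _ _ (adjSwap_lt_adjSwap i hab ?_) hlt
      rintro ⟨rfl, rfl⟩
      simp only [Perm.mul_apply, adjSwap_castSucc, adjSwap_succ] at hlt
      exact lt_asymm hi hlt

theorem isArtin (hL : IsLift σ L) : IsArtin σ := by
  constructor
  · intro i j h
    rw [← hL.apply_adjSwap i, ← hL.apply_adjSwap j, ← hL.mul, ← hL.mul, adjSwap_comm h] <;>
    · intro a b hab
      simp only [Fin.lt_def, val_adjSwap] at *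
      split_ifs <;> omega
  · intro i j h
    have hb := adjSwap_braid h
    have l1 : L (adjSwap i * adjSwap j * adjSwap i) = σ i * σ j * σ i := by
      rw [hL.mul_adjSwap, hL.mul_adjSwap, hL.apply_adjSwap] <;>
      · simp only [Fin.lt_def, Perm.mul_apply, val_adjSwap, Fin.val_castSucc, Fin.val_succ]
        simp only [← h]
        split_ifs <;> omega
    have l2 : L (adjSwap j * adjSwap i * adjSwap j) = σ j * σ i * σ j := by
      rw [hL.mul_adjSwap, hL.mul_adjSwap, hL.apply_adjSwap] <;>
      · simp only [Fin.lt_def, Perm.mul_apply, val_adjSwap, Fin.val_castSucc, Fin.val_succ]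
        simp only [← h]
        split_ifs <;> omega
    rw [← l1, ← l2, hb]

/-- The family of generators extended by `1`. -/
def ext (σ : Fin k → Γ) (i : ℕ) : Γ := if h : i < k then σ ⟨i, h⟩ else 1

theorem prod_range (hL : IsLift σ L) {m : ℕ} (hm : m ≤ k) (w : Perm (Fin (k + 1)))
    (h : ∀ a, (w a : ℕ) = if (a : ℕ) < m then (a : ℕ) + 1 else if (a : ℕ) = m then 0 else a) :
    L w = ((List.range m).map (ext σ)).prod := by
  induction m generalizing w with
  | zero =>
    have : w = 1 := by
      ext a
      rw [h]
      simp only [Perm.one_apply]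
      split_ifs <;> omega
    simp [this, hL.one]
  | succ m ih =>
    have hmk : m < k := hm
    clear hm
    have hd : w (Fin.succ ⟨m, hmk⟩) < w (Fin.castSucc ⟨m, hmk⟩) := by
      simp [Fin.lt_def, h]
    rw [hL.apply_of_descent hd, ih hmk.le, List.range_succ]
    · simp [ext, hmk]
    · intro a
      rw [Perm.mul_apply, h, val_adjSwap]
      dsimp only
      split_ifs <;> omega

theorem prod_range_reverse (hL : IsLift σ L) {m : ℕ} (hm : m ≤ k) (w : Perm (Fin (k + 1)))
    (h : ∀ a, (w a : ℕ) = if (a : ℕ) < m then (a : ℕ) else if (a : ℕ) = m then k else a - 1) :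
    L w = ((((List.range k).drop m).reverse).map (ext σ)).prod := by
  induction hm using Nat.decreasingInduction generalizing w with
  | self =>
    have : w = 1 := by
      ext a
      rw [h]
      have := a.is_lt
      simp only [Perm.one_apply]
      split_ifs <;> omega
    rw [this, hL.one, List.drop_eq_nil_of_le (by simp)]
    rfl
  | of_succ m hmk ih =>
    have hd : w (Fin.succ ⟨m, hmk⟩) < w (Fin.castSucc ⟨m, hmk⟩) := by
      simp [Fin.lt_def, h, hmk]
    rw [hL.apply_of_descent hd, ih, List.drop_eq_getElem_cons (i := m) (by simpa using hmk)]
    · simp [ext, hmk]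
    · intro a
      have := a.is_lt
      rw [Perm.mul_apply, h, val_adjSwap]
      dsimp only
      split_ifs <;> omega

end IsLift

/-- The permutation recording the relative order of the values of an injective tuple. -/
def rk (a : Fin (k + 1) → ℝ) : Perm (Fin (k + 1)) := (Tuple.sort a)⁻¹

theorem rk_lt_rk {a : Fin (k + 1) → ℝ} (ha : Function.Injective a) {i j : Fin (k + 1)} :
    rk a i < rk a j ↔ a i < a j := by
  have h : StrictMono (a ∘ Tuple.sort a) :=
    (Tuple.monotone_sort a).strictMono_of_injective (ha.comp (Tuple.sort a).injective)
  rw [← h.lt_iff_lt]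
  simp [rk]

theorem rk_unique {a : Fin (k + 1) → ℝ} (ha : Function.Injective a) {r : Perm (Fin (k + 1))}
    (h : ∀ i j, a i < a j → r i < r j) : rk a = r := by
  have : (r * (rk a)⁻¹) = 1 := eq_one_of_strictMono fun x y hxy => h _ _ <| by
    rw [← rk_lt_rk ha]
    simpa using hxy
  exact (mul_inv_eq_one.1 this).symm

theorem rk_congr {a b : Fin (k + 1) → ℝ} (ha : Function.Injective a) (hb : Function.Injective b)
    (h : ∀ i j, a i < a j → b i < b j) : rk a = rk b :=
  rk_unique ha fun i j hij => (rk_lt_rk hb).2 (h i j hij)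

theorem rk_comp {a : Fin (k + 1) → ℝ} (ha : Function.Injective a) (π : Perm (Fin (k + 1))) :
    rk (a ∘ π) = rk a * π :=
  rk_unique (ha.comp π.injective) fun _ _ h => (rk_lt_rk ha).2 h

/-- The lift of the permutation comparing the orders of two injective tuples. -/
def cmpLift {Γ : Type*} (L : Perm (Fin (k + 1)) → Γ) (a b : Fin (k + 1) → ℝ) : Γ :=
  L (rk a * (rk b)⁻¹)

theorem cmpLift_comp {Γ : Type*} (L : Perm (Fin (k + 1)) → Γ) {a b : Fin (k + 1) → ℝ}
    (ha : Function.Injective a) (hb : Function.Injective b) (π : Perm (Fin (k + 1))) :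
    cmpLift L (a ∘ π) (b ∘ π) = cmpLift L a b := by
  unfold cmpLift
  rw [rk_comp ha, rk_comp hb]
  congr 1
  group

/-- The order of `b` agrees with those of `a` and `c` on the pairs where these agree. -/
def Btw (a b c : Fin (k + 1) → ℝ) : Prop := ∀ i j, a i < a j → c i < c j → b i < b j

theorem IsLift.cmpLift_self {σ : Fin k → Γ} {L : Perm (Fin (k + 1)) → Γ} (hL : IsLift σ L)
    (a : Fin (k + 1) → ℝ) : cmpLift L a a = 1 := by
  rw [cmpLift, mul_inv_cancel, hL.one]

theorem IsLift.cmpLift_mul {σ : Fin k → Γ} {L : Perm (Fin (k + 1)) → Γ} (hL : IsLift σ L)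
    {a b c : Fin (k + 1) → ℝ} (ha : Function.Injective a) (hb : Function.Injective b)
    (hc : Function.Injective c) (h : Btw a b c) :
    cmpLift L a b * cmpLift L b c = cmpLift L a c := by
  unfold cmpLift
  rw [← hL.mul]
  · congr 1
    group
  · intro x y hxy hlt
    obtain ⟨i, rfl⟩ := (rk c).surjective x
    obtain ⟨j, rfl⟩ := (rk c).surjective y
    simp only [Perm.mul_apply, Perm.inv_def, symm_apply_apply, rk_lt_rk ha, rk_lt_rk hb,
      rk_lt_rk hc] at *
    by_contra! hle
    have : a i < a j := lt_of_le_of_ne hle fun e => by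
      have := ha e
      subst this
      exact lt_irrefl _ hxy
    exact lt_asymm hlt (h i j this hxy)

theorem rk_eq_finRotate_mul {a b : Fin (k + 1) → ℝ} (ha : Function.Injective a)
    (hb : Function.Injective b) (κ : Fin (k + 1)) (ha' : ∀ i ≠ κ, a κ < a i)
    (hb' : ∀ i ≠ κ, b i < b κ) (h : ∀ i j, i ≠ κ → j ≠ κ → a i < a j → b i < b j) :
    rk a = finRotate (k + 1) * rk b := by
  have hκ : rk b κ = Fin.last k := by
    obtain ⟨j, hj⟩ := (rk b).surjective (Fin.last k)
    rcases eq_or_ne j κ with rfl | hne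
    · exact hj
    · exact absurd ((rk_lt_rk hb).2 (hb' j hne)) (by rw [hj]; exact (Fin.le_last _).not_gt)
  have hne (i : Fin (k + 1)) (hi : i ≠ κ) : rk b i ≠ Fin.last k := fun e =>
    hi ((rk b).injective (e.trans hκ.symm))
  refine rk_unique ha fun i j hij => ?_
  rcases eq_or_ne i κ with rfl | hi
  · have hj : j ≠ i := by
      rintro rfl
      exact lt_irrefl _ hij
    rw [Fin.lt_def, Perm.mul_apply, Perm.mul_apply, hκ, coe_finRotate_of_ne_last (hne j hj)]
    simp
  · rcases eq_or_ne j κ with rfl | hj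
    · exact absurd hij (lt_asymm (ha' i hi))
    · rw [Fin.lt_def, Perm.mul_apply, Perm.mul_apply, coe_finRotate_of_ne_last (hne j hj),
        coe_finRotate_of_ne_last (hne i hi)]
      have := (rk_lt_rk hb).2 (h i j hi hj hij)
      rw [Fin.lt_def] at this
      omega

theorem val_finRotate (a : Fin (k + 1)) :
    (finRotate (k + 1) a : ℕ) =
      if (a : ℕ) < k then (a : ℕ) + 1 else if (a : ℕ) = k then 0 else a := by
  have := a.is_lt
  split_ifs with h1 h2
  · exact coe_finRotate_of_ne_last (by simpa [Fin.ext_iff] using h1.ne)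
  · rw [show a = Fin.last k from Fin.ext h2]
    simp
  · omega

theorem val_finRotate_inv (a : Fin (k + 1)) :
    ((finRotate (k + 1))⁻¹ a : ℕ) =
      if (a : ℕ) < 0 then (a : ℕ) else if (a : ℕ) = 0 then k else a - 1 := by
  obtain ⟨b, rfl⟩ := (finRotate (k + 1)).surjective a
  have := b.is_lt
  have h := val_finRotate b
  rw [Perm.inv_def, symm_apply_apply]
  split_ifs at h ⊢ <;> omega

theorem IsLift.cmpLift_mul_cmpLift {σ : Fin k → Γ} {L : Perm (Fin (k + 1)) → Γ} (hL : IsLift σ L)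
    (hs : ((List.range k).map (IsLift.ext σ)).prod *
      ((List.range k).reverse.map (IsLift.ext σ)).prod = 1)
    {a b : Fin (k + 1) → ℝ} (ha : Function.Injective a)
    (hb : Function.Injective b) (κ : Fin (k + 1)) (ha' : ∀ i ≠ κ, a κ < a i)
    (hb' : ∀ i ≠ κ, b i < b κ) (h : ∀ i j, i ≠ κ → j ≠ κ → a i < a j → b i < b j) :
    cmpLift L a b * cmpLift L b a = 1 := by
  have e := rk_eq_finRotate_mul ha hb κ ha' hb' h
  have e1 : cmpLift L a b = L (finRotate (k + 1)) := by
    rw [cmpLift, e]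
    congr 1
    group
  have e2 : cmpLift L b a = L (finRotate (k + 1))⁻¹ := by
    rw [cmpLift, e]
    congr 1
    group
  rw [e1, e2, hL.prod_range le_rfl _ val_finRotate,
    hL.prod_range_reverse (Nat.zero_le k) _ val_finRotate_inv, List.drop_zero, hs]

/-- The sphere braid group given by its presentation. -/
abbrev SphereBraid (k : ℕ) : Type := PresentedGroup (ArtinRels k ∪ {sphereWord k})

/-- The standard generators of the sphere braid group. -/
def gen (i : Fin k) : SphereBraid k := PresentedGroup.of i

theorem mk_br (i : ℕ) : PresentedGroup.mk (ArtinRels k ∪ {sphereWord k}) (br k i) =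
    IsLift.ext (gen (k := k)) i := by
  unfold br IsLift.ext
  split_ifs
  · rfl
  · simp

theorem isArtin_gen : IsArtin (gen (k := k)) := by
  have hext (i : Fin k) : gen i = PresentedGroup.mk (ArtinRels k ∪ {sphereWord k}) (br k i) := by
    simp [mk_br, IsLift.ext]
  constructor
  · intro i j h
    rw [← mul_inv_eq_one, hext, hext]
    simp only [← map_mul, ← map_inv]
    exact PresentedGroup.one_of_mem (.inl (.inl ⟨i, j, h, j.2, rfl⟩))
  · intro i j h
    rw [← mul_inv_eq_one, hext, hext]
    simp only [← map_mul, ← map_inv]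
    exact PresentedGroup.one_of_mem (.inl (.inr ⟨i, by omega, by rw [← h]⟩))

theorem prod_gen : ((List.range k).map (IsLift.ext (gen (k := k)))).prod *
      ((List.range k).reverse.map (IsLift.ext (gen (k := k)))).prod = 1 := by
  have : PresentedGroup.mk (ArtinRels k ∪ {sphereWord k}) (((List.range k).map (br k)).prod *
      ((List.range k).reverse.map (br k)).prod) = 1 :=
    PresentedGroup.one_of_mem (x := sphereWord k) (.inr rfl)
  rw [map_mul, map_list_prod, map_list_prod, List.map_map, List.map_map] at this
  simpa only [Function.comp_def, mk_br] using this

/-- The homomorphism induced by a lift satisfying the sphere relation. -/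
theorem exists_hom {σ : Fin k → Γ} (hσ : IsArtin σ)
    (hs : ((List.range k).map (IsLift.ext σ)).prod *
      ((List.range k).reverse.map (IsLift.ext σ)).prod = 1) :
    ∃ Φ : SphereBraid k →* Γ, ∀ i, Φ (gen i) = σ i := by
  have hbr (i : ℕ) : FreeGroup.lift σ (br k i) = IsLift.ext σ i := by
    unfold br IsLift.ext
    split_ifs <;> simp
  refine ⟨PresentedGroup.toGroup (f := σ) ?_, fun i => PresentedGroup.toGroup.of _⟩
  rintro r ((⟨i, j, hij, hj, rfl⟩ | ⟨i, hi, rfl⟩) | rfl)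
  · simp only [map_mul, map_inv, hbr]
    rw [mul_inv_eq_one]
    simpa [IsLift.ext, hj, show i < k by omega] using hσ.comm ⟨i, by omega⟩ ⟨j, hj⟩ hij
  · simp only [map_mul, map_inv, hbr]
    rw [mul_inv_eq_one]
    simpa [IsLift.ext, hi, show i < k by omega] using hσ.braid ⟨i, by omega⟩ ⟨i + 1, hi⟩ rfl
  · rw [sphereWord, map_mul, map_list_prod, map_list_prod, List.map_map, List.map_map]
    simpa only [Function.comp_def, hbr] using hs

end ArtinLift

end

section

open Set Topology

namespace SphereConf

theorem vec_ne_zero {v : Fin 2 → ℂ} {i : Fin 2} (h : v i ≠ 0) : v ≠ 0 := fun e => h (by simp [e])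

/-- The point of the projective line with affine coordinate `z`. -/
def aff (z : ℂ) : CP 1 := .mk ℂ ![z, 1] (vec_ne_zero (i := 1) (by simp))

/-- The point of the projective line with coordinate `w` at infinity. -/
def infc (w : ℂ) : CP 1 := .mk ℂ ![1, w] (vec_ne_zero (i := 0) (by simp))

/-- The affine coordinate, with value zero at infinity. -/
def zc (p : CP 1) : ℂ := p.rep 0 / p.rep 1

theorem mk_eq_aff {v : Fin 2 → ℂ} (hv : v ≠ 0) {z : ℂ} :
    Projectivization.mk ℂ v hv = aff z ↔ v 1 ≠ 0 ∧ v 0 / v 1 = z := by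
  rw [aff, Projectivization.mk_eq_mk_iff']
  constructor
  · rintro ⟨a, rfl⟩
    have ha : a ≠ 0 := by rintro rfl; simp at hv
    simp [ha]
  · rintro ⟨h, rfl⟩
    refine ⟨v 1, ?_⟩
    ext i; fin_cases i <;> simp [mul_div_cancel₀, h]

theorem mk_eq_infc {v : Fin 2 → ℂ} (hv : v ≠ 0) {w : ℂ} :
    Projectivization.mk ℂ v hv = infc w ↔ v 0 ≠ 0 ∧ v 1 / v 0 = w := by
  rw [infc, Projectivization.mk_eq_mk_iff']
  constructor
  · rintro ⟨a, rfl⟩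
    have ha : a ≠ 0 := by rintro rfl; simp at hv
    simp [ha]
  · rintro ⟨h, rfl⟩
    refine ⟨v 0, ?_⟩
    ext i; fin_cases i <;> simp [mul_div_cancel₀, h]

theorem zc_mk {v : Fin 2 → ℂ} (hv : v ≠ 0) : zc (.mk ℂ v hv) = v 0 / v 1 := by
  obtain ⟨a, ha⟩ := Projectivization.exists_smul_eq_mk_rep ℂ v hv
  rw [zc, ← ha]
  simp [Units.smul_def, mul_div_mul_left]

@[simp] theorem zc_aff (z : ℂ) : zc (aff z) = z := by simp [aff, zc_mk]

@[simp] theorem zc_infc (w : ℂ) : zc (infc w) = w⁻¹ := by simp [infc, zc_mk]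

@[simp] theorem aff_ne_infc_zero (z : ℂ) : aff z ≠ infc 0 := by
  simp only [aff, ne_eq]
  rw [mk_eq_infc]
  simp

theorem infc_eq_aff {w : ℂ} (hw : w ≠ 0) : infc w = aff w⁻¹ := by
  rw [infc, mk_eq_aff]
  simp [hw]

theorem infc_eq_infc_zero {w : ℂ} : infc w = infc 0 ↔ w = 0 := by
  simp [infc, Projectivization.mk_eq_mk_iff', eq_comm]

theorem aff_zc {p : CP 1} (hp : p ≠ infc 0) : aff (zc p) = p := by
  induction p using Projectivization.ind with | h v hv =>
  rw [zc_mk, eq_comm, mk_eq_aff]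
  refine ⟨fun h => hp ?_, rfl⟩
  rw [mk_eq_infc]
  refine ⟨fun h' => hv ?_, by simp [h]⟩
  ext i; fin_cases i <;> simpa

theorem aff_injective : Function.Injective aff := fun a b h => by simpa using congrArg zc h

theorem infc_injective : Function.Injective infc := fun a b h => by simpa using congrArg zc h

theorem isQuotientMap_mk : IsQuotientMap fun v : {v : Fin (1 + 1) → ℂ // v ≠ 0} =>
    (Projectivization.mk ℂ v.1 v.2 : CP 1) :=
  isQuotientMap_quotient_mk' (s := projectivizationSetoid ℂ (Fin (1 + 1) → ℂ))

theorem isOpenMap_chart {φ : ℂ → CP 1} {i j : Fin 2} (h : ∀ (v : Fin 2 → ℂ) (hv : v ≠ 0) (z : ℂ),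
    Projectivization.mk ℂ v hv = φ z ↔ v j ≠ 0 ∧ v i / v j = z) : IsOpenMap φ := by
  intro U hU
  rw [← isQuotientMap_mk.isOpen_preimage]
  have e : (fun v : {v : Fin (1 + 1) → ℂ // v ≠ 0} =>
      (Projectivization.mk ℂ v.1 v.2 : CP 1)) ⁻¹' (φ '' U) =
      {v | v.1 j ≠ 0 ∧ v.1 i / v.1 j ∈ U} := by
    ext ⟨v, hv⟩
    simp only [mem_image, mem_ofPred_eq, mem_preimage]
    constructor
    · rintro ⟨z, hz, e⟩
      obtain ⟨h1, rfl⟩ := (h v hv z).1 e.symm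
      exact ⟨h1, hz⟩
    · rintro ⟨h1, h2⟩
      exact ⟨_, h2, ((h v hv _).2 ⟨h1, rfl⟩).symm⟩
  rw [e, isOpen_iff_mem_nhds]
  rintro ⟨v, hv⟩ ⟨h1, h2⟩
  have c (l : Fin 2) : Continuous fun u : {v : Fin 2 → ℂ // v ≠ 0} => u.1 l :=
    (continuous_apply l).comp continuous_subtype_val
  filter_upwards [(c j).continuousAt.eventually_ne h1,
    ((c i).continuousAt.div (c j).continuousAt h1).preimage_mem_nhds (hU.mem_nhds h2)]
    with u hu hu' using ⟨hu, hu'⟩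

theorem continuous_chart {f : ℂ → Fin 2 → ℂ} (hf : Continuous f) (h0 : ∀ z, f z ≠ 0) :
    Continuous fun z => (Projectivization.mk ℂ (f z) (h0 z) : CP 1) :=
  isQuotientMap_mk.continuous.comp (hf.subtype_mk h0)

theorem isOpenEmbedding_aff : IsOpenEmbedding aff :=
  .of_continuous_injective_isOpenMap (continuous_chart (f := fun z => ![z, 1])
    (by refine continuous_pi fun i => ?_; fin_cases i <;> simp <;> fun_prop)
    fun z => vec_ne_zero (i := 1) (by simp)) aff_injective
    (isOpenMap_chart fun _ hv _ => mk_eq_aff hv)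

theorem isOpenEmbedding_infc : IsOpenEmbedding infc :=
  .of_continuous_injective_isOpenMap (continuous_chart (f := fun z => ![1, z])
    (by refine continuous_pi fun i => ?_; fin_cases i <;> simp <;> fun_prop)
    fun z => vec_ne_zero (i := 0) (by simp)) infc_injective
    (isOpenMap_chart fun _ hv _ => mk_eq_infc hv)

theorem eventually_ne_infc_zero {p : CP 1} (hp : p ≠ infc 0) : ∀ᶠ p' in 𝓝 p, p' ≠ infc 0 := by
  rw [← aff_zc hp]
  filter_upwards [isOpenEmbedding_aff.isOpen_range.mem_nhds (mem_range_self (zc p))]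
  rintro _ ⟨z, rfl⟩
  simp

theorem continuousAt_zc {p : CP 1} (hp : p ≠ infc 0) : ContinuousAt zc p := by
  rw [← aff_zc hp, ← isOpenEmbedding_aff.continuousAt_iff]
  have : zc ∘ aff = id := by ext; simp
  rw [this]
  exact continuousAt_id

/-! ### Configurations -/

variable {k : ℕ}

/-- The unordered configuration space of `k + 1` points of the projective line. -/
abbrev Conf (k : ℕ) : Type := Cconf (k + 1) 1 1

theorem injective_aff_natCast : Function.Injective fun i : Fin (k + 1) => aff (i : ℕ) :=
  fun i j h => by simpa [Fin.ext_iff] using aff_injective h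

/-- The quotient map from ordered to unordered configurations. -/
def toConf (x : Fconf (k + 1) 1 1) : Conf k := Quotient.mk _ x

theorem isQuotientMap_toConf : IsQuotientMap (toConf (k := k)) :=
  isQuotientMap_quotient_mk' (s := permSetoid (k + 1) 1 1)

theorem toConf_eq {x y : Fconf (k + 1) 1 1} :
    toConf x = toConf y ↔ ∃ π : Equiv.Perm (Fin (k + 1)), y.1 = x.1 ∘ π :=
  Quotient.eq (r := permSetoid (k + 1) 1 1)

variable [NeZero k]

theorem mem_Fconf {x : Fin (k + 1) → CP 1} : x ∈ Fconf (k + 1) 1 1 ↔ Function.Injective x := by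
  refine ⟨fun h => h.1, fun h => ⟨h, ?_⟩⟩
  have hk : 0 < k := Nat.pos_of_ne_zero (NeZero.ne k)
  have hne : x 0 ≠ x ⟨1, by omega⟩ := h.ne (by simp [Fin.ext_iff])
  have hi := (Projectivization.independent_pair_iff_ne _ _).2 hne
  rw [Projectivization.independent_iff] at hi
  apply le_antisymm
  · exact (Submodule.finrank_le _).trans (by simp)
  · have e := finrank_span_eq_card hi
    rw [Fintype.card_fin] at e
    refine e.symm.le.trans ?_
    refine Submodule.finrank_mono (Submodule.span_mono ?_)
    rintro _ ⟨i, rfl⟩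
    fin_cases i
    exacts [⟨0, rfl⟩, ⟨_, rfl⟩]

open Classical in
/-- The unordered configuration underlying a tuple of distinct points
(with a junk value otherwise). -/
def cfg (x : Fin (k + 1) → CP 1) : Conf k :=
  if h : Function.Injective x then toConf ⟨x, mem_Fconf.2 h⟩
  else toConf ⟨_, mem_Fconf.2 injective_aff_natCast⟩

theorem cfg_of_injective {x : Fin (k + 1) → CP 1} (h : Function.Injective x) :
    cfg x = toConf ⟨x, mem_Fconf.2 h⟩ := dif_pos h

theorem exists_cfg_eq (c : Conf k) : ∃ x, Function.Injective x ∧ cfg x = c := by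
  induction c using Quotient.inductionOn with | h x =>
  exact ⟨x.1, x.2.1, cfg_of_injective x.2.1⟩

theorem cfg_eq_iff {x y : Fin (k + 1) → CP 1} (hx : Function.Injective x)
    (hy : Function.Injective y) : cfg x = cfg y ↔ ∃ π : Equiv.Perm (Fin (k + 1)), y = x ∘ π := by
  rw [cfg_of_injective hx, cfg_of_injective hy, toConf_eq]

theorem cfg_comp (x : Fin (k + 1) → CP 1) (π : Equiv.Perm (Fin (k + 1))) : cfg (x ∘ π) = cfg x := by
  by_cases hx : Function.Injective x
  · exact ((cfg_eq_iff hx (hx.comp π.injective)).2 ⟨π, rfl⟩).symm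
  · have : ¬ Function.Injective (x ∘ π) := by simpa using hx
    rw [cfg, cfg, dif_neg hx, dif_neg this]

theorem continuousOn_cfg : ContinuousOn cfg {x : Fin (k + 1) → CP 1 | Function.Injective x} := by
  rw [continuousOn_iff_continuous_domRestrict]
  have : ({x : Fin (k + 1) → CP 1 | Function.Injective x}.domRestrict cfg) =
      toConf ∘ fun x => ⟨x.1, mem_Fconf.2 x.2⟩ := by
    ext x; exact cfg_of_injective x.2
  rw [this]
  exact isQuotientMap_toConf.continuous.comp (continuous_subtype_val.subtype_mk _)

theorem isOpen_image_cfg {U : Set (Fin (k + 1) → CP 1)} (hU : IsOpen U)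
    (hi : ∀ x ∈ U, Function.Injective x) : IsOpen (cfg '' U) := by
  rw [← isQuotientMap_toConf.isOpen_preimage]
  have e : toConf ⁻¹' (cfg '' U) =
      ⋃ π : Equiv.Perm (Fin (k + 1)), {x | x.1 ∘ π ∈ U} := by
    ext x
    simp only [mem_preimage, mem_image, mem_iUnion, mem_ofPred_eq]
    rw [← cfg_of_injective x.2.1]
    constructor
    · rintro ⟨y, hy, e⟩
      obtain ⟨π, rfl⟩ := (cfg_eq_iff x.2.1 (hi y hy)).1 e.symm
      exact ⟨π, hy⟩
    · rintro ⟨π, h⟩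
      exact ⟨_, h, cfg_comp _ _⟩
  rw [e]
  refine isOpen_iUnion fun π => hU.preimage ?_
  exact continuous_pi fun i => (continuous_apply (π i)).comp continuous_subtype_val

end SphereConf

end

section

open Set Topology unitInterval

namespace SphereConf

open ArtinLift

variable {k : ℕ}

/-- The linear form interpolating between the real part (`s = 0`) and the imaginary part
(`s = 1`). -/
def slant (s : ℝ) : ℂ →L[ℝ] ℝ := (1 - s) • Complex.reCLM + s • Complex.imCLM

theorem slant_apply (s : ℝ) (z : ℂ) : slant s z = (1 - s) * z.re + s * z.im := rfl

theorem exists_slant_injOn (T : Set (Fin (k + 1))) {z : Fin (k + 1) → ℂ} (hz : InjOn z T) :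
    ∃ s ∈ I, InjOn (slant s ∘ z) T := by
  have hfin : (⋃ p : Fin (k + 1) × Fin (k + 1),
      {s : ℝ | z p.1 ≠ z p.2 ∧ slant s (z p.1) = slant s (z p.2)}).Finite := by
    refine Set.finite_iUnion fun p => Set.Subsingleton.finite ?_
    rintro s ⟨hne, hs⟩ t ⟨-, ht⟩
    simp only [slant_apply] at hs ht
    by_contra hst
    have h : (s - t) * ((z p.1).im - (z p.2).im - ((z p.1).re - (z p.2).re)) = 0 := by linarith
    have h2 := (mul_eq_zero.1 h).resolve_left (sub_ne_zero.2 hst)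
    refine hne (Complex.ext ?_ ?_)
    · linear_combination hs - s * h2
    · linear_combination hs + (1 - s) * h2
  have hinf : (I : Set ℝ).Infinite := Set.Icc_infinite one_pos
  obtain ⟨s, hs, hs'⟩ := hinf.exists_notMem_finite hfin
  refine ⟨s, hs, fun i hi j hj h => hz hi hj ?_⟩
  by_contra hne
  exact hs' (mem_iUnion.2 ⟨(i, j), hne, h⟩)

/-- Replace the value of `a` at `κ` by one smaller than all other values. -/
def low (κ : Fin (k + 1)) (a : Fin (k + 1) → ℝ) (i : Fin (k + 1)) : ℝ :=
  if i = κ then -1 - ∑ j, |a j| else a i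

theorem low_of_ne {κ i : Fin (k + 1)} (h : i ≠ κ) (a : Fin (k + 1) → ℝ) : low κ a i = a i :=
  if_neg h

theorem low_lt {κ i : Fin (k + 1)} (h : i ≠ κ) (a : Fin (k + 1) → ℝ) : low κ a κ < low κ a i := by
  rw [low_of_ne h, low, if_pos rfl]
  have := Finset.single_le_sum (f := fun j => |a j|) (fun j _ => abs_nonneg _) (Finset.mem_univ i)
  have := neg_abs_le (a i)
  linarith

theorem low_comp (κ : Fin (k + 1)) (a : Fin (k + 1) → ℝ) (π : Equiv.Perm (Fin (k + 1))) :
    low (π⁻¹ κ) (a ∘ π) = low κ a ∘ π := by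
  ext i
  simp only [low, Function.comp_apply, Equiv.Perm.eq_inv_iff_eq]
  rw [Equiv.sum_comp π (fun j => |a j|)]

theorem low_injective {κ : Fin (k + 1)} {a : Fin (k + 1) → ℝ} (h : InjOn a {κ}ᶜ) :
    Function.Injective (low κ a) := by
  intro i j e
  by_cases hi : i = κ <;> by_cases hj : j = κ
  · rw [hi, hj]
  · subst hi; exact absurd e (low_lt hj a).ne
  · subst hj; exact absurd e (low_lt hi a).ne'
  · rw [low_of_ne hi, low_of_ne hj] at e
    exact h hi hj e

/-- The point `x κ` is much closer to infinity than all other points of the configuration. -/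
def Far (κ : Fin (k + 1)) (x : Fin (k + 1) → CP 1) : Prop :=
  ∃ w, x κ = infc w ∧ ∀ i ≠ κ, x i ≠ infc 0 ∧ ‖w‖ * (9 * (1 + ‖zc (x i)‖)) < 1

theorem Far.unique {κ κ' : Fin (k + 1)} {x : Fin (k + 1) → CP 1} (h : Far κ x) (h' : Far κ' x) :
    κ = κ' := by
  by_contra hne
  obtain ⟨w, hw, h⟩ := h
  obtain ⟨w', hw', h'⟩ := h'
  obtain ⟨h1, h2⟩ := h κ' (Ne.symm hne)
  obtain ⟨h1', h2'⟩ := h' κ hne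
  rw [hw'] at h1 h2
  rw [hw] at h1' h2'
  rw [Ne, infc_eq_infc_zero, ← Ne, ← norm_pos_iff] at h1 h1'
  simp only [zc_infc, norm_inv] at h2 h2'
  have e1 : ‖w'‖ * ‖w'‖⁻¹ = 1 := mul_inv_cancel₀ h1.ne'
  have e2 : ‖w‖ * ‖w‖⁻¹ = 1 := mul_inv_cancel₀ h1'.ne'
  have a1 : ‖w‖ * ‖w'‖⁻¹ < 1 := by nlinarith [inv_pos.2 h1, mul_pos h1' (inv_pos.2 h1)]
  have a2 : ‖w'‖ * ‖w‖⁻¹ < 1 := by nlinarith [inv_pos.2 h1', mul_pos h1 (inv_pos.2 h1')]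
  rw [← div_eq_mul_inv, div_lt_one h1] at a1
  rw [← div_eq_mul_inv, div_lt_one h1'] at a2
  exact lt_asymm a1 a2

theorem Far.comp {κ : Fin (k + 1)} {x : Fin (k + 1) → CP 1} (h : Far κ x)
    (π : Equiv.Perm (Fin (k + 1))) : Far (π⁻¹ κ) (x ∘ π) := by
  obtain ⟨w, hw, h⟩ := h
  refine ⟨w, by simpa using hw, fun i hi => h _ ?_⟩
  rwa [Ne, ← Equiv.Perm.eq_inv_iff_eq]

theorem Far.ne_of_ne {κ i : Fin (k + 1)} {x : Fin (k + 1) → CP 1} (h : Far κ x) (hi : i ≠ κ) :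
    x i ≠ infc 0 := by
  obtain ⟨w, -, h⟩ := h
  exact (h i hi).1

theorem Far.lt {κ i : Fin (k + 1)} {x : Fin (k + 1) → CP 1} (h : Far κ x) (hi : i ≠ κ)
    (hκ : x κ ≠ infc 0) : 9 * (1 + ‖zc (x i)‖) < ‖zc (x κ)‖ := by
  obtain ⟨w, hw, h⟩ := h
  have h2 := (h i hi).2
  rw [hw] at hκ ⊢
  rw [Ne, infc_eq_infc_zero, ← Ne, ← norm_pos_iff] at hκ
  rw [zc_infc, norm_inv, lt_inv_comm₀ (by positivity) hκ, ← one_div, lt_div_iff₀ (by positivity)]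
  exact h2

theorem far_of_lt {κ : Fin (k + 1)} {x : Fin (k + 1) → CP 1} (hx : ∀ i, x i ≠ infc 0)
    (hκ : zc (x κ) ≠ 0) (h : ∀ i ≠ κ, 9 * (1 + ‖zc (x i)‖) < ‖zc (x κ)‖) : Far κ x := by
  refine ⟨(zc (x κ))⁻¹, ?_, fun i hi => ⟨hx i, ?_⟩⟩
  · rw [infc_eq_aff (inv_ne_zero hκ), inv_inv, aff_zc (hx κ)]
  · rw [norm_inv, inv_mul_lt_one₀ (norm_pos_iff.2 hκ)]
    exact h i hi

theorem Far.eventually {κ : Fin (k + 1)} {x : Fin (k + 1) → CP 1} (h : Far κ x) :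
    ∀ᶠ y in 𝓝 x, Far κ y := by
  obtain ⟨w, hw, h⟩ := h
  let φ (i : Fin (k + 1)) : ℂ → CP 1 := if i = κ then infc else aff
  have hφ : IsOpenEmbedding (Pi.map φ) := .piMap fun i => by
    by_cases hi : i = κ
    · simpa [φ, hi] using isOpenEmbedding_infc
    · simpa [φ, hi] using isOpenEmbedding_aff
  have e : x = Pi.map φ (fun i => if i = κ then w else zc (x i)) := by
    ext i
    by_cases hi : i = κ
    · subst hi; simp [φ, hw]
    · simp [φ, hi, aff_zc (h i hi).1]
  rw [e, ← hφ.map_nhds_eq, Filter.eventually_map]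
  have key : ∀ᶠ y : Fin (k + 1) → ℂ in 𝓝 (fun i => if i = κ then w else zc (x i)),
      ∀ i, i ≠ κ → ‖y κ‖ * (9 * (1 + ‖y i‖)) < 1 := by
    refine Filter.eventually_all.2 fun i => ?_
    by_cases hi : i = κ
    · simp [hi]
    · have c : Continuous fun y : Fin (k + 1) → ℂ => ‖y κ‖ * (9 * (1 + ‖y i‖)) := by fun_prop
      have := c.continuousAt.eventually_lt (x₀ := fun i => if i = κ then w else zc (x i))
        (continuousAt_const (y := (1 : ℝ))) (by simpa [hi] using (h i hi).2)
      filter_upwards [this] with y hy _ using hy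
  filter_upwards [key] with y hy
  refine ⟨y κ, by simp [φ], fun i hi => ?_⟩
  simpa [φ, hi] using hy i hi

theorem isOpen_strictMono {m : ℕ} (s : ℝ) :
    IsOpen {z : Fin m → ℂ | StrictMono (slant s ∘ z)} := by
  simp only [StrictMono, Function.comp_apply]
  simp only [ofPred_forall]
  refine isOpen_iInter_of_finite fun i => isOpen_iInter_of_finite fun j =>
    isOpen_iInter_of_finite fun _ => isOpen_lt ?_ ?_ <;> fun_prop

theorem convex_strictMono {m : ℕ} (s : ℝ) :
    Convex ℝ {z : Fin m → ℂ | StrictMono (slant s ∘ z)} := by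
  intro z hz z' hz' a b ha hb hab i j hij
  have h1 := hz hij
  have h2 := hz' hij
  simp only [Function.comp_apply, Pi.add_apply, Pi.smul_apply, map_add, map_smul, smul_eq_mul]
    at h1 h2 ⊢
  rcases ha.eq_or_lt with rfl | ha
  · obtain rfl : b = 1 := by linarith
    linarith
  · nlinarith

/-- Coordinates around the configurations with one point at infinity. -/
def scaleHomeo : (ℂ × (Fin k → ℂ)) ≃ₜ (Fin (k + 1) → ℂ) where
  toFun p := Fin.cons (p.1 / (9 * (1 + ‖p.2‖) : ℝ)) p.2
  invFun z := (z 0 * (9 * (1 + ‖Fin.tail z‖) : ℝ), Fin.tail z)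
  left_inv p := by
    have : ((9 * (1 + ‖p.2‖) : ℝ) : ℂ) ≠ 0 := by
      rw [Complex.ofReal_ne_zero]; positivity
    ext
    · simp only [Fin.cons_zero, Fin.tail_cons]
      rw [div_mul_cancel₀ _ this]
    · simp
  right_inv z := by
    have : ((9 * (1 + ‖Fin.tail z‖) : ℝ) : ℂ) ≠ 0 := by
      rw [Complex.ofReal_ne_zero]; positivity
    simp only
    rw [mul_div_cancel_right₀ _ this, Fin.cons_self_tail]
  continuous_toFun := by
    refine continuous_pi fun i => Fin.cases ?_ (fun i => ?_) i
    · simp only [Fin.cons_zero]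
      refine continuous_fst.div (by fun_prop) fun p => ?_
      rw [Complex.ofReal_ne_zero]; positivity
    · simp only [Fin.cons_succ]
      fun_prop
  continuous_invFun := by
    have : Continuous fun z : Fin (k + 1) → ℂ => Fin.tail z := by
      unfold Fin.tail; fun_prop
    fun_prop

/-- The ordered configuration with one point near infinity with given coordinates. -/
def vtuple (p : ℂ × (Fin k → ℂ)) : Fin (k + 1) → CP 1 :=
  Pi.map (Fin.cons infc fun _ => aff) (scaleHomeo p)

theorem isOpenEmbedding_vtuple : IsOpenEmbedding (vtuple (k := k)) :=
  (IsOpenEmbedding.piMap fun i => by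
    refine Fin.cases ?_ (fun i => ?_) i
    · exact isOpenEmbedding_infc
    · exact isOpenEmbedding_aff).comp scaleHomeo.isOpenEmbedding

theorem vtuple_zero (p : ℂ × (Fin k → ℂ)) :
    vtuple p 0 = infc (p.1 / (9 * (1 + ‖p.2‖) : ℝ)) := rfl

theorem vtuple_succ (p : ℂ × (Fin k → ℂ)) (i : Fin k) : vtuple p i.succ = aff (p.2 i) := rfl

theorem far_vtuple {p : ℂ × (Fin k → ℂ)} (h : ‖p.1‖ < 1) : Far 0 (vtuple p) := by
  refine ⟨_, vtuple_zero p, fun i hi => ?_⟩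
  obtain ⟨i, rfl⟩ := Fin.exists_succ_eq.2 hi
  rw [vtuple_succ]
  refine ⟨aff_ne_infc_zero _, ?_⟩
  rw [zc_aff, norm_div, Complex.norm_of_nonneg (by positivity), div_mul_eq_mul_div,
    div_lt_one (by positivity)]
  have := norm_le_pi_norm p.2 i
  nlinarith [norm_nonneg p.1, norm_nonneg (p.2 i)]

theorem Far.injective {κ : Fin (k + 1)} {x : Fin (k + 1) → CP 1} (h : Far κ x)
    (hx : InjOn x {κ}ᶜ) : Function.Injective x := by
  have key : ∀ i ≠ κ, x i ≠ x κ := fun i hi e => by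
    have h1 := h.ne_of_ne hi
    have h2 := h.lt hi (e ▸ h1)
    rw [← e] at h2
    linarith [norm_nonneg (zc (x i))]
  intro i j e
  by_cases hi : i = κ <;> by_cases hj : j = κ
  · rw [hi, hj]
  · subst hi; exact absurd e.symm (key j hj)
  · subst hj; exact absurd e (key i hi)
  · exact hx hi hj e

theorem strictMono_low_vtuple {s : ℝ} {p : ℂ × (Fin k → ℂ)} (h : StrictMono (slant s ∘ p.2)) :
    StrictMono (low 0 (slant s ∘ zc ∘ vtuple p)) := by
  intro i j hij
  obtain ⟨j, rfl⟩ := Fin.exists_succ_eq.2 (ne_of_gt ((Fin.zero_le i).trans_lt hij))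
  refine Fin.cases (fun _ => low_lt (Fin.succ_ne_zero j) _) (fun i hij => ?_) i hij
  rw [low_of_ne (Fin.succ_ne_zero _), low_of_ne (Fin.succ_ne_zero _)]
  simpa [vtuple_succ] using h (Fin.succ_lt_succ_iff.1 hij)

theorem injOn_of_low {κ : Fin (k + 1)} {a : Fin (k + 1) → ℝ}
    (h : Function.Injective (low κ a)) : InjOn a {κ}ᶜ := fun i hi j hj e =>
  h (by rw [low_of_ne hi, low_of_ne hj, e])

theorem injective_vtuple {s : ℝ} {p : ℂ × (Fin k → ℂ)} (h : ‖p.1‖ < 1)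
    (hs : StrictMono (slant s ∘ p.2)) : Function.Injective (vtuple p) :=
  (far_vtuple h).injective fun i hi j hj e =>
    injOn_of_low (strictMono_low_vtuple hs).injective hi hj (by simp [e])

/-- Positions of the points of the base configuration. -/
def basePos (j : Fin (k + 1)) : ℝ := if j = 0 then -(18 * (k + 1)) else (j : ℕ)

/-- The base configuration, on the diagonal line of the affine chart. -/
def baseTuple (j : Fin (k + 1)) : ℂ := ⟨basePos j, basePos j⟩

theorem slant_baseTuple (s : ℝ) (j : Fin (k + 1)) : slant s (baseTuple j) = basePos j := by
  rw [slant_apply, baseTuple]; ring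

theorem strictMono_basePos : StrictMono (basePos (k := k)) := by
  intro i j hij
  obtain ⟨j, rfl⟩ := Fin.exists_succ_eq.2 (ne_of_gt ((Fin.zero_le i).trans_lt hij))
  by_cases hi : i = 0
  · simp only [basePos, hi, if_true, Fin.succ_ne_zero, if_false]
    have : (0 : ℝ) ≤ (j.succ : ℕ) := Nat.cast_nonneg _
    have : (0 : ℝ) ≤ k := Nat.cast_nonneg _
    linarith
  · simp only [basePos, hi, Fin.succ_ne_zero, if_false]
    exact_mod_cast hij

theorem slant_comp_baseTuple (s : ℝ) : slant s ∘ baseTuple = basePos (k := k) :=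
  funext (slant_baseTuple s)

theorem norm_baseTuple_le (j : Fin (k + 1)) : ‖baseTuple j‖ ≤ 2 * |basePos j| := by
  refine (Complex.norm_le_abs_re_add_abs_im _).trans ?_
  simp only [baseTuple]
  linarith

theorem injective_baseTuple : Function.Injective (baseTuple (k := k)) :=
  Function.Injective.of_comp (f := slant 0) (by
    rw [slant_comp_baseTuple]; exact strictMono_basePos.injective)

theorem far_baseTuple : Far 0 (aff ∘ baseTuple (k := k)) := by
  have hk : (0 : ℝ) ≤ k := Nat.cast_nonneg _
  have h0 : 18 * ((k : ℝ) + 1) ≤ ‖baseTuple (k := k) 0‖ := by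
    have := Complex.abs_re_le_norm (baseTuple (k := k) 0)
    simp only [baseTuple, basePos, if_true] at this ⊢
    rwa [abs_neg, abs_of_nonneg (by positivity)] at this
  refine far_of_lt (fun i => aff_ne_infc_zero _) ?_ fun i hi => ?_
  · rw [Function.comp_apply, zc_aff, ← norm_pos_iff]
    linarith
  · simp only [Function.comp_apply, zc_aff]
    have h1 := norm_baseTuple_le i
    rw [basePos, if_neg hi, Nat.abs_cast] at h1
    have : ((i : ℕ) : ℝ) ≤ k := by exact_mod_cast Nat.lt_succ_iff.1 i.2
    linarith

variable [NeZero k]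

theorem isOpen_simplyConnected_image {E : Type*} [NormedAddCommGroup E] [NormedSpace ℝ E]
    {D : Set E} (hD : IsOpen D) (hc : Convex ℝ D) (hne : D.Nonempty)
    {φ : E → Fin (k + 1) → CP 1} (hφ : IsOpenEmbedding φ)
    (hi : ∀ d ∈ D, Function.Injective (φ d)) (hinj : InjOn (fun d => cfg (φ d)) D) :
    IsOpen ((fun d => cfg (φ d)) '' D) ∧
      SimplyConnectedSpace ((fun d => cfg (φ d)) '' D : Set (Conf k)) := by
  have : ContractibleSpace D := hc.contractibleSpace hne
  let g : D → Conf k := fun d => cfg (φ d)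
  have hg : IsOpenEmbedding g := by
    refine .of_continuous_injective_isOpenMap ?_ (fun a b h => Subtype.ext (hinj a.2 b.2 h)) ?_
    · exact continuousOn_cfg.comp_continuous (hφ.continuous.comp continuous_subtype_val)
        fun d => hi d d.2
    · intro U hU
      have e : g '' U = cfg '' (φ '' (Subtype.val '' U)) := by simp only [image_image, g]
      rw [e]
      refine isOpen_image_cfg (hφ.isOpenMap _ (hD.isOpenMap_subtype_val _ hU)) ?_
      rintro _ ⟨_, ⟨d, -, rfl⟩, rfl⟩
      exact hi d d.2
  have e : (fun d => cfg (φ d)) '' D = range g := by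
    rw [image_eq_range]
  rw [e]
  refine ⟨hg.isOpen_range, ?_⟩
  have := hg.toIsEmbedding.toHomeomorph.symm.contractibleSpace
  infer_instance

/-- The configurations of finite points whose images under `slant s` are distinct. -/
def chartW (s : ℝ) : Set (Conf k) :=
  (fun z => cfg (aff ∘ z)) '' {z : Fin (k + 1) → ℂ | StrictMono (slant s ∘ z)}

theorem chartW_eq (s : ℝ) : chartW (k := k) s =
    (fun z => cfg (Pi.map (fun _ => aff) z)) '' {z | StrictMono (slant s ∘ z)} := rfl

theorem mem_chartW {s : ℝ} {x : Fin (k + 1) → CP 1} (hx : Function.Injective x) :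
    cfg x ∈ chartW s ↔ (∀ i, x i ≠ infc 0) ∧ Function.Injective (slant s ∘ zc ∘ x) := by
  constructor
  · rintro ⟨z, hz, e⟩
    have hz' : Function.Injective z := Function.Injective.of_comp hz.injective
    obtain ⟨π, rfl⟩ := (cfg_eq_iff (aff_injective.comp hz') hx).1 e
    refine ⟨fun i => aff_ne_infc_zero _, ?_⟩
    have : slant s ∘ zc ∘ (aff ∘ z) ∘ π = (slant s ∘ z) ∘ π := by ext; simp
    rw [this]
    exact hz.injective.comp π.injective
  · rintro ⟨h1, h2⟩
    let π := Tuple.sort (slant s ∘ zc ∘ x)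
    refine ⟨zc ∘ x ∘ π, (Tuple.monotone_sort (slant s ∘ zc ∘ x)).strictMono_of_injective
      (h2.comp π.injective), ?_⟩
    have : aff ∘ zc ∘ x ∘ π = x ∘ π := by ext; simp [aff_zc (h1 _)]
    simp only [this, cfg_comp]

theorem isOpen_simplyConnected_chartW (s : ℝ) (hne : {z : Fin (k + 1) → ℂ |
    StrictMono (slant s ∘ z)}.Nonempty) :
    IsOpen (chartW (k := k) s) ∧ SimplyConnectedSpace (chartW (k := k) s) := by
  rw [chartW_eq]
  refine isOpen_simplyConnected_image (isOpen_strictMono s) (convex_strictMono s) hne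
    (.piMap fun _ => isOpenEmbedding_aff) (fun z hz => ?_) fun z hz z' hz' e => ?_
  · exact aff_injective.comp (Function.Injective.of_comp hz.injective)
  · obtain ⟨π, e⟩ := (cfg_eq_iff (x := Pi.map (fun _ => aff) z)
      (aff_injective.comp (Function.Injective.of_comp hz.injective))
      (aff_injective.comp (Function.Injective.of_comp hz'.injective))).1 e
    have e' : z' = z ∘ π := aff_injective.comp_left e
    have : π = 1 := eq_one_of_strictMono fun i j h => by
      have := hz' h
      rw [e'] at this
      exact hz.lt_iff_lt.1 this
    rw [e', this]
    rfl

/-- The configurations with one point far from all the others, whose images under `slant s`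
are distinct. -/
def chartV (s : ℝ) : Set (Conf k) :=
  (fun p => cfg (vtuple p)) '' {p : ℂ × (Fin k → ℂ) | ‖p.1‖ < 1 ∧ StrictMono (slant s ∘ p.2)}

theorem mem_chartV {s : ℝ} {x : Fin (k + 1) → CP 1} (hx : Function.Injective x) :
    cfg x ∈ chartV s ↔ ∃ κ, Far κ x ∧ Function.Injective (low κ (slant s ∘ zc ∘ x)) := by
  constructor
  · rintro ⟨p, ⟨h1, h2⟩, e⟩
    obtain ⟨π, rfl⟩ := (cfg_eq_iff (injective_vtuple h1 h2) hx).1 e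
    refine ⟨_, (far_vtuple h1).comp π, ?_⟩
    have := low_comp 0 (slant s ∘ zc ∘ vtuple p) π
    rw [← Function.comp_assoc, ← Function.comp_assoc, Function.comp_assoc (slant s), this]
    exact (strictMono_low_vtuple h2).injective.comp π.injective
  · rintro ⟨κ, h1, h2⟩
    let π := Tuple.sort (low κ (slant s ∘ zc ∘ x))
    have hπ : StrictMono (low κ (slant s ∘ zc ∘ x) ∘ π) :=
      (Tuple.monotone_sort (low κ (slant s ∘ zc ∘ x))).strictMono_of_injective
      (h2.comp π.injective)
    have h0 : π 0 = κ := by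
      by_contra h0
      have h3 := low_lt h0 (slant s ∘ zc ∘ x)
      have h4 := hπ.monotone (Fin.zero_le (π⁻¹ κ))
      simp only [Function.comp_apply, Equiv.Perm.inv_def, Equiv.apply_symm_apply] at h4
      linarith
    have hne (i : Fin k) : π i.succ ≠ κ := fun h => by
      rw [← h0] at h
      exact Fin.succ_ne_zero _ (π.injective h)
    obtain ⟨w, hw, h1⟩ := h1
    let q : Fin k → ℂ := fun i => zc (x (π i.succ))
    refine ⟨(w * (9 * (1 + ‖q‖) : ℝ), q), ⟨?_, ?_⟩, ?_⟩
    · have : ∃ i, ‖q‖ = ‖q i‖ := by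
        obtain ⟨i, hi⟩ := Finite.exists_max fun i => ‖q i‖
        exact ⟨i, le_antisymm ((pi_norm_le_iff_of_nonneg (norm_nonneg _)).2 hi)
          (norm_le_pi_norm q i)⟩
      obtain ⟨i, hi⟩ := this
      rw [norm_mul, Complex.norm_of_nonneg (by positivity), hi]
      exact (h1 _ (hne i)).2
    · intro i j hij
      have := hπ (Fin.succ_lt_succ_iff.2 hij)
      simpa only [Function.comp_apply, low_of_ne (hne _)] using this
    · have : vtuple (w * (9 * (1 + ‖q‖) : ℝ), q) = x ∘ π := by
        ext i
        refine Fin.cases ?_ (fun i => ?_) i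
        · rw [vtuple_zero, mul_div_cancel_right₀, Function.comp_apply, h0, hw]
          rw [Complex.ofReal_ne_zero]; positivity
        · rw [vtuple_succ, Function.comp_apply]
          exact aff_zc (h1 _ (hne i)).1
      simp only [this, cfg_comp]

theorem isOpen_simplyConnected_chartV (s : ℝ) (hne : {p : ℂ × (Fin k → ℂ) |
    ‖p.1‖ < 1 ∧ StrictMono (slant s ∘ p.2)}.Nonempty) :
    IsOpen (chartV (k := k) s) ∧ SimplyConnectedSpace (chartV (k := k) s) := by
  have hset : {p : ℂ × (Fin k → ℂ) | ‖p.1‖ < 1 ∧ StrictMono (slant s ∘ p.2)} =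
      Metric.ball 0 1 ×ˢ {q | StrictMono (slant s ∘ q)} := by
    ext p; simp
  refine isOpen_simplyConnected_image ?_ ?_ hne isOpenEmbedding_vtuple
    (fun p hp => injective_vtuple hp.1 hp.2) fun p hp p' hp' e => ?_
  · rw [hset]; exact Metric.isOpen_ball.prod (isOpen_strictMono s)
  · rw [hset]; exact (convex_ball 0 1).prod (convex_strictMono s)
  · obtain ⟨π, e⟩ := (cfg_eq_iff (injective_vtuple hp.1 hp.2) (injective_vtuple hp'.1 hp'.2)).1 e
    have h0 : 0 = π⁻¹ 0 := (far_vtuple hp'.1).unique (e ▸ (far_vtuple hp.1).comp π)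
    have : π = 1 := eq_one_of_strictMono fun i j h => by
      have h3 := strictMono_low_vtuple hp'.2 h
      rw [e, ← Function.comp_assoc, ← Function.comp_assoc, Function.comp_assoc (slant s), h0,
        low_comp] at h3
      exact (strictMono_low_vtuple hp.2).lt_iff_lt.1 h3
    rw [this] at e
    exact isOpenEmbedding_vtuple.injective e.symm

/-- The charts of the configuration space: `(s, false)` for `chartW s`, `(s, true)` for
`chartV s`. -/
def chart (i : I × Bool) : Set (Conf k) := if i.2 then chartV i.1 else chartW i.1

theorem base_mem_chart (i : I × Bool) : cfg (aff ∘ baseTuple (k := k)) ∈ chart i := by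
  have hx : Function.Injective (aff ∘ baseTuple (k := k)) :=
    aff_injective.comp injective_baseTuple
  have e : ⇑(slant i.1) ∘ zc ∘ aff ∘ baseTuple (k := k) = basePos := by
    rw [← slant_comp_baseTuple i.1]; ext; simp
  obtain ⟨s, _ | _⟩ := i
  · refine (mem_chartW hx).2 ⟨fun i => aff_ne_infc_zero _, ?_⟩
    rw [e]
    exact strictMono_basePos.injective
  · refine (mem_chartV hx).2 ⟨0, far_baseTuple, low_injective ?_⟩
    rw [e]
    exact strictMono_basePos.injective.injOn

theorem exists_mem_chart (c : Conf k) : ∃ i : I × Bool, c ∈ chart i := by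
  obtain ⟨x, hx, rfl⟩ := exists_cfg_eq c
  have hz (T : Set (Fin (k + 1))) (hT : ∀ i ∈ T, x i ≠ infc 0) : InjOn (zc ∘ x) T :=
    fun i hi j hj e => hx (by rw [← aff_zc (hT i hi), ← aff_zc (hT j hj)]; exact congrArg aff e)
  by_cases h : ∃ κ, x κ = infc 0
  · obtain ⟨κ, hκ⟩ := h
    have hne : ∀ i ≠ κ, x i ≠ infc 0 := fun i hi e => hi (hx (e.trans hκ.symm))
    obtain ⟨s, hs, h⟩ := exists_slant_injOn {κ}ᶜ (hz {κ}ᶜ hne)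
    refine ⟨(⟨s, hs⟩, true), (mem_chartV hx).2 ⟨κ, ⟨0, hκ, fun i hi => ⟨hne i hi, by simp⟩⟩,
      low_injective h⟩⟩
  · push Not at h
    obtain ⟨s, hs, h'⟩ := exists_slant_injOn univ (hz univ fun i _ => h i)
    exact ⟨(⟨s, hs⟩, false), (mem_chartW hx).2 ⟨h, injOn_univ.1 h'⟩⟩

theorem nonempty_of_chart (i : I × Bool) : (chart (k := k) i).Nonempty := ⟨_, base_mem_chart i⟩

theorem isOpen_simplyConnected_chart (i : I × Bool) :
    IsOpen (chart (k := k) i) ∧ SimplyConnectedSpace (chart (k := k) i) := by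
  obtain ⟨s, _ | _⟩ := i
  · exact isOpen_simplyConnected_chartW s (nonempty_of_chart (k := k) (s, false)).of_image
  · exact isOpen_simplyConnected_chartV s (nonempty_of_chart (k := k) (s, true)).of_image

/-- The configuration space as covered by its charts. -/
def cover (k : ℕ) [NeZero k] : PointedCover (Conf k) (I × Bool) where
  carrier := chart
  isOpen_carrier i := (isOpen_simplyConnected_chart i).1
  simplyConnected i := (isOpen_simplyConnected_chart i).2
  base := cfg (aff ∘ baseTuple)
  base_mem := base_mem_chart
  exists_mem := exists_mem_chart

end SphereConf

end

section

open Set Topology unitInterval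

namespace SphereConf

open ArtinLift

universe u

variable {k : ℕ} {G : Type u} [Group G]

theorem abs_slant_le {s : ℝ} (hs : s ∈ I) (z : ℂ) : |slant s z| ≤ ‖z‖ := by
  have h1 := Complex.abs_re_le_norm z
  have h2 := Complex.abs_im_le_norm z
  obtain ⟨h0, h01⟩ := hs
  rw [abs_le] at *
  rw [slant_apply]
  constructor <;> nlinarith

theorem slant_lt_slant_of_far {p q : ℂ} (hp : p.re ≤ p.im) (hpq : 9 * (1 + ‖q‖) < ‖p‖) {s t : ℝ}
    (hs : s ∈ I) (ht : t ∈ I) (hst : s ≤ t) (h : slant s q < slant s p) :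
    slant t q < slant t p := by
  simp only [slant_apply] at *
  obtain ⟨hs0, hs1⟩ := hs
  obtain ⟨ht0, ht1⟩ := ht
  rcases le_or_gt (p.re - q.re) (p.im - q.im) with hd | hd
  · nlinarith
  have h1 := abs_le.1 (Complex.abs_re_le_norm q)
  have h2 := abs_le.1 (Complex.abs_im_le_norm q)
  have h3 : 2 * |p.re| + 2 * ‖q‖ ≥ ‖p‖ := by
    have h4 := Complex.norm_le_abs_re_add_abs_im p
    have h5 : |p.im| ≤ |p.re| + 2 * ‖q‖ := by
      rw [abs_le]
      have := neg_abs_le p.re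
      have := le_abs_self p.re
      constructor <;> linarith
    linarith
  have hδ : 0 < p.re - q.re - (p.im - q.im) := by linarith
  have hδ' : p.re - q.re - (p.im - q.im) ≤ 2 * ‖q‖ := by linarith
  have hs2 : s * (p.re - q.re - (p.im - q.im)) ≤ 2 * ‖q‖ := by nlinarith
  have ht2 : t * (p.re - q.re - (p.im - q.im)) ≤ 2 * ‖q‖ := by nlinarith
  have hs3 : 0 ≤ s * (p.re - q.re - (p.im - q.im)) := by positivity
  rcases abs_cases p.re with ⟨h6, h7⟩ | ⟨h6, h7⟩ <;> rw [h6] at h3 <;> linarith [norm_nonneg q]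

theorem slant_extreme {p : ℂ} (hp : |p.im - p.re| < 1) {s : ℝ} (hs : s ∈ I) :
    (∀ q : ℂ, 9 * (1 + ‖q‖) < ‖p‖ → slant s q < slant s p) ∨
      ∀ q : ℂ, 9 * (1 + ‖q‖) < ‖p‖ → slant s p < slant s q := by
  have h1 := Complex.norm_le_abs_re_add_abs_im p
  have h2 : |p.im| ≤ |p.re| + 1 := by
    have := abs_sub_abs_le_abs_sub p.im p.re
    linarith
  have h3 : |slant s p - p.re| ≤ 1 := by
    have e : slant s p - p.re = s * (p.im - p.re) := by rw [slant_apply]; ring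
    rw [e, abs_mul, abs_of_nonneg hs.1]
    nlinarith [abs_nonneg (p.im - p.re), hs.1, hs.2]
  rw [abs_le] at h3
  rcases abs_cases p.re with ⟨h6, h7⟩ | ⟨h6, h7⟩ <;> [left; right] <;> intro q hq <;>
    have h4 := abs_le.1 (abs_slant_le hs q) <;> linarith [norm_nonneg q]

/-! ### Comparison of orders along a family -/

/-- The lift comparing the orders at two members of a one-parameter family. -/
def cmpFam (L : Equiv.Perm (Fin (k + 1)) → G) (a : ℝ → Fin (k + 1) → ℝ) (s t : ℝ) : G :=
  if s ≤ t then cmpLift L (a s) (a t) else (cmpLift L (a t) (a s))⁻¹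

theorem cmpFam_inv {τ : Fin k → G} {L : Equiv.Perm (Fin (k + 1)) → G} (hL : IsLift τ L)
    (a : ℝ → Fin (k + 1) → ℝ) (s t : ℝ) : (cmpFam L a s t)⁻¹ = cmpFam L a t s := by
  unfold cmpFam
  rcases lt_trichotomy s t with h | rfl | h
  · rw [if_pos h.le, if_neg h.not_ge]
  · simp [hL.cmpLift_self]
  · rw [if_neg h.not_ge, if_pos h.le, inv_inv]

theorem cmpFam_mul {τ : Fin k → G} {L : Equiv.Perm (Fin (k + 1)) → G} (hL : IsLift τ L)
    {a : ℝ → Fin (k + 1) → ℝ} (hB : ∀ r s t, r ≤ s → s ≤ t → Btw (a r) (a s) (a t)) {r s t : ℝ}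
    (hr : Function.Injective (a r)) (hs : Function.Injective (a s))
    (ht : Function.Injective (a t)) : cmpFam L a r s * cmpFam L a s t = cmpFam L a r t := by
  have key {r s t : ℝ} (hrs : r ≤ s) (hst : s ≤ t) (hr : Function.Injective (a r))
      (hs : Function.Injective (a s)) (ht : Function.Injective (a t)) :
      cmpFam L a r s * cmpFam L a s t = cmpFam L a r t := by
    simp only [cmpFam, if_pos hrs, if_pos hst, if_pos (hrs.trans hst)]
    exact hL.cmpLift_mul hr hs ht (hB _ _ _ hrs hst)
  have inv := cmpFam_inv hL a
  rcases le_total r s with h1 | h1 <;> rcases le_total s t with h2 | h2 <;>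
    rcases le_total r t with h3 | h3
  · exact key h1 h2 hr hs ht
  · exact key h1 h2 hr hs ht
  · rw [← key h3 h2 hr ht hs, ← inv t s, mul_inv_cancel_right]
  · rw [← inv t s, ← inv t r, ← key h3 h1 ht hr hs, mul_inv_rev, mul_inv_cancel_left]
  · rw [← key h1 h3 hs hr ht, ← inv s r, inv_mul_cancel_left]
  · rw [← inv s r, ← inv t r, ← key h2 h3 hs ht hr, mul_inv_rev, mul_assoc, inv_mul_cancel, mul_one]
  · rw [← inv s r, ← inv t s, ← inv t r, ← key h2 h1 ht hs hr, mul_inv_rev]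
  · rw [← inv s r, ← inv t s, ← inv t r, ← key h2 h1 ht hs hr, mul_inv_rev]

theorem cmpFam_congr (L : Equiv.Perm (Fin (k + 1)) → G) {a b : ℝ → Fin (k + 1) → ℝ} {s t : ℝ}
    (hs : rk (a s) = rk (b s)) (ht : rk (a t) = rk (b t)) : cmpFam L a s t = cmpFam L b s t := by
  simp only [cmpFam, cmpLift, hs, ht]

theorem cmpFam_comp (L : Equiv.Perm (Fin (k + 1)) → G) {a : ℝ → Fin (k + 1) → ℝ} {s t : ℝ}
    (hs : Function.Injective (a s)) (ht : Function.Injective (a t))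
    (π : Equiv.Perm (Fin (k + 1))) : cmpFam L (fun s => a s ∘ π) s t = cmpFam L a s t := by
  simp only [cmpFam, cmpLift_comp L hs ht, cmpLift_comp L ht hs]

theorem rk_low {κ : Fin (k + 1)} {a : Fin (k + 1) → ℝ} (ha : Function.Injective a)
    (h : ∀ i ≠ κ, a κ < a i) : rk (low κ a) = rk a := by
  refine rk_congr (low_injective ha.injOn) ha fun i j hij => ?_
  by_cases hi : i = κ
  · subst hi
    refine h j fun e => ?_
    subst e
    exact lt_irrefl _ hij
  · by_cases hj : j = κ
    · subst hj
      exact absurd hij (low_lt hi a).not_gt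
    · rwa [low_of_ne hi, low_of_ne hj] at hij

/-! ### The cocycle on ordered configurations -/

/-- The values of `slant s` on the points of a configuration. -/
def ord (s : ℝ) (x : Fin (k + 1) → CP 1) : Fin (k + 1) → ℝ := slant s ∘ zc ∘ x

theorem ord_apply (s : ℝ) (x : Fin (k + 1) → CP 1) (i : Fin (k + 1)) :
    ord s x i = slant s (zc (x i)) := rfl

theorem ord_comp (s : ℝ) (x : Fin (k + 1) → CP 1) (π : Equiv.Perm (Fin (k + 1))) :
    ord s (x ∘ π) = ord s x ∘ π := rfl

theorem btw_ord (x : Fin (k + 1) → CP 1) (r s t : ℝ) (hrs : r ≤ s) (hst : s ≤ t) :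
    Btw (ord r x) (ord s x) (ord t x) := by
  intro i j h1 h2
  simp only [ord_apply, slant_apply] at *
  by_contra! h3
  have key : ∀ a b : ℝ, (1 - r) * a + r * b < 0 → (1 - t) * a + t * b < 0 →
      (1 - s) * a + s * b < 0 := by
    intro a b h1 h2
    rcases le_total a b with h | h <;> nlinarith
  have := key ((zc (x i)).re - (zc (x j)).re) ((zc (x i)).im - (zc (x j)).im) (by linarith)
    (by linarith)
  linarith

theorem btw_low {a b c : Fin (k + 1) → ℝ} (κ : Fin (k + 1)) (h : Btw a b c) :
    Btw (low κ a) (low κ b) (low κ c) := by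
  intro i j h1 h2
  by_cases hj : j = κ
  · subst hj
    by_cases hi : i = j
    · subst hi; exact absurd h1 (lt_irrefl _)
    · exact absurd h1 (low_lt hi a).not_gt
  · by_cases hi : i = κ
    · subst hi; exact low_lt hj b
    · rw [low_of_ne hi, low_of_ne hj] at *
      exact h i j h1 h2

/-- The ordered configuration `x` represents a point of `chart i`, where `x κ` is the far point
if there is one. -/
def Good (κ : Fin (k + 1)) (i : I × Bool) (x : Fin (k + 1) → CP 1) : Prop :=
  if i.2 then Far κ x ∧ Function.Injective (low κ (ord i.1 x))
  else (∀ j, x j ≠ infc 0) ∧ Function.Injective (ord i.1 x)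

theorem good_true {κ : Fin (k + 1)} {s : I} {x : Fin (k + 1) → CP 1} :
    Good κ (s, true) x ↔ Far κ x ∧ Function.Injective (low κ (ord s x)) := Iff.rfl

theorem good_false {κ : Fin (k + 1)} {s : I} {x : Fin (k + 1) → CP 1} :
    Good κ (s, false) x ↔ (∀ j, x j ≠ infc 0) ∧ Function.Injective (ord s x) := by
  simp [Good]

theorem Good.injective_low {κ : Fin (k + 1)} {i : I × Bool} {x : Fin (k + 1) → CP 1}
    (h : Good κ i x) : Function.Injective (low κ (ord i.1 x)) := by
  obtain ⟨s, _ | _⟩ := i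
  · exact low_injective (good_false.1 h).2.injOn
  · exact h.2

theorem Good.comp {κ : Fin (k + 1)} {i : I × Bool} {x : Fin (k + 1) → CP 1} (h : Good κ i x)
    (π : Equiv.Perm (Fin (k + 1))) : Good (π⁻¹ κ) i (x ∘ π) := by
  obtain ⟨s, _ | _⟩ := i
  · rw [good_false] at *
    exact ⟨fun j => h.1 _, h.2.comp π.injective⟩
  · rw [good_true] at *
    refine ⟨h.1.comp π, ?_⟩
    rw [ord_comp, low_comp]
    exact h.2.comp π.injective

/-- The comparison between the charts with and without a far point. -/
def crossLift (L : Equiv.Perm (Fin (k + 1)) → G) (κ : Fin (k + 1)) (x : Fin (k + 1) → CP 1)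
    (s : ℝ) : G :=
  if (zc (x κ)).re < (zc (x κ)).im then cmpLift L (low κ (ord s x)) (ord s x)
  else (cmpLift L (ord s x) (low κ (ord s x)))⁻¹

theorem crossLift_mul {τ : Fin k → G} {L : Equiv.Perm (Fin (k + 1)) → G} (hL : IsLift τ L)
    {κ : Fin (k + 1)} {x : Fin (k + 1) → CP 1} (hκ : Far κ x) (hx : x κ ≠ infc 0) {s t : ℝ}
    (hsI : s ∈ I) (htI : t ∈ I)
    (hs : Function.Injective (ord s x)) (ht : Function.Injective (ord t x)) :
    crossLift L κ x s * cmpFam L (fun s => ord s x) s t =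
      cmpFam L (fun s => low κ (ord s x)) s t * crossLift L κ x t := by
  wlog hst : s ≤ t generalizing s t
  · have := this htI hsI ht hs (le_of_not_ge hst)
    rw [← cmpFam_inv hL _ t s, ← cmpFam_inv hL _ t s, eq_inv_mul_iff_mul_eq, ← mul_assoc, ← this,
      mul_inv_cancel_right]
  have hs' : Function.Injective (low κ (ord s x)) := low_injective hs.injOn
  have ht' : Function.Injective (low κ (ord t x)) := low_injective ht.injOn
  simp only [cmpFam, if_pos hst, crossLift]
  split_ifs with hp
  · rw [hL.cmpLift_mul hs' hs ht, hL.cmpLift_mul hs' ht' ht]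
    · intro i j h1 h2
      by_cases hj : j = κ
      · subst hj
        by_cases hi : i = j
        · subst hi; exact absurd h1 (lt_irrefl _)
        · exact absurd h1 (low_lt hi _).not_gt
      · by_cases hi : i = κ
        · subst hi; exact low_lt hj _
        · rwa [low_of_ne hi, low_of_ne hj]
    · intro i j h1 h2
      by_cases hj : j = κ
      · subst hj
        by_cases hi : i = j
        · subst hi; exact absurd h1 (lt_irrefl _)
        · exact absurd h1 (low_lt hi _).not_gt
      · by_cases hi : i = κ
        · subst hi
          by_contra h3
          exact lt_asymm h2 (slant_lt_slant_of_far hp.le (hκ.lt hj hx) hsI htI hst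
            (lt_of_le_of_ne (not_lt.1 h3) fun e => hj (hs e)))
        · rwa [low_of_ne hi, low_of_ne hj] at h1
  · rw [eq_mul_inv_iff_mul_eq, mul_assoc, inv_mul_eq_iff_eq_mul, hL.cmpLift_mul hs ht ht',
      hL.cmpLift_mul hs hs' ht']
    · intro i j h1 h2
      by_cases hj : j = κ
      · subst hj
        by_cases hi : i = j
        · subst hi; exact absurd h1 (lt_irrefl _)
        · exact absurd h2 (low_lt hi _).not_gt
      · by_cases hi : i = κ
        · subst hi; exact low_lt hj _
        · rwa [low_of_ne hi, low_of_ne hj]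
    · intro i j h1 h2
      by_cases hj : j = κ
      · subst hj
        by_cases hi : i = j
        · subst hi; exact absurd h1 (lt_irrefl _)
        · exact absurd h2 (low_lt hi _).not_gt
      · by_cases hi : i = κ
        · subst hi
          have := slant_lt_slant_of_far (p := -zc (x i)) (q := -zc (x j)) (by simpa using hp)
            (by simpa using hκ.lt hj hx) hsI htI hst (by simpa [ord_apply] using h1)
          simpa [ord_apply] using this
        · rwa [low_of_ne hi, low_of_ne hj] at h2

theorem crossLift_of_near_diagonal {τ : Fin k → G} {L : Equiv.Perm (Fin (k + 1)) → G}
    (hL : IsLift τ L) (hσ : ((List.range k).map (IsLift.ext τ)).prod *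
      ((List.range k).reverse.map (IsLift.ext τ)).prod = 1)
    {κ : Fin (k + 1)} {x : Fin (k + 1) → CP 1} (hκ : Far κ x) (hx : x κ ≠ infc 0)
    (hd : |(zc (x κ)).im - (zc (x κ)).re| < 1) {s : ℝ} (hsI : s ∈ I)
    (hs : Function.Injective (ord s x)) :
    crossLift L κ x s = (cmpLift L (ord s x) (low κ (ord s x)))⁻¹ := by
  unfold crossLift
  split_ifs with hp
  · rw [eq_inv_iff_mul_eq_one]
    rcases slant_extreme hd hsI with h | h
    · refine hL.cmpLift_mul_cmpLift hσ (low_injective hs.injOn) hs κ (fun i hi => low_lt hi _)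
        (fun i hi => h _ (hκ.lt hi hx)) fun i j hi hj h => ?_
      rwa [low_of_ne hi, low_of_ne hj] at h
    · have e := rk_low hs fun i hi => h _ (hκ.lt hi hx)
      rw [cmpLift, cmpLift, e, mul_inv_cancel, hL.one, mul_one]
  · rfl

/-- The comparison of a chart with those having a far point. -/
def leg (L : Equiv.Perm (Fin (k + 1)) → G) (κ : Fin (k + 1)) (x : Fin (k + 1) → CP 1)
    (i : I × Bool) : G := if i.2 then 1 else crossLift L κ x i.1

/-- The cocycle of the braid covering, on ordered configurations. -/
def coc (L : Equiv.Perm (Fin (k + 1)) → G) (κ : Fin (k + 1)) (x : Fin (k + 1) → CP 1)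
    (i j : I × Bool) : G :=
  if i.2 = false ∧ j.2 = false then cmpFam L (fun s => ord s x) i.1 j.1
  else (leg L κ x i)⁻¹ * cmpFam L (fun s => low κ (ord s x)) i.1 j.1 * leg L κ x j

theorem coc_false (L : Equiv.Perm (Fin (k + 1)) → G) (κ : Fin (k + 1)) (x : Fin (k + 1) → CP 1)
    (s t : I) : coc L κ x (s, false) (t, false) = cmpFam L (fun s => ord s x) s t :=
  if_pos ⟨rfl, rfl⟩

variable {τ : Fin k → G} {L : Equiv.Perm (Fin (k + 1)) → G} {κ : Fin (k + 1)} {i j l : I × Bool}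
  {x : Fin (k + 1) → CP 1}

theorem coc_eq_of_far (hL : IsLift τ L) (hκ : Far κ x) (hi : Good κ i x) (hj : Good κ j x) :
    coc L κ x i j =
      (leg L κ x i)⁻¹ * cmpFam L (fun s => low κ (ord s x)) i.1 j.1 * leg L κ x j := by
  unfold coc
  split_ifs with h
  · obtain ⟨s, _⟩ := i
    obtain ⟨t, _⟩ := j
    obtain ⟨rfl, rfl⟩ := h
    rw [good_false] at *
    have := crossLift_mul hL hκ (hi.1 κ) s.2 t.2 hi.2 hj.2
    simp only [leg, Bool.false_eq_true, if_false]
    rw [mul_assoc, ← this, inv_mul_cancel_left]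
  · rfl

theorem far_or_false (hi : Good κ i x) (hj : Good κ j x) :
    Far κ x ∨ (i.2 = false ∧ j.2 = false) := by
  obtain ⟨s, _ | _⟩ := i
  · obtain ⟨t, _ | _⟩ := j
    · exact .inr ⟨rfl, rfl⟩
    · exact .inl hj.1
  · exact .inl hi.1

theorem coc_mul (hL : IsLift τ L) (hi : Good κ i x) (hj : Good κ j x) (hl : Good κ l x) :
    coc L κ x i j * coc L κ x j l = coc L κ x i l := by
  by_cases hκ : Far κ x
  · rw [coc_eq_of_far hL hκ hi hj, coc_eq_of_far hL hκ hj hl, coc_eq_of_far hL hκ hi hl,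
      ← cmpFam_mul hL (a := fun s => low κ (ord s x))
        (fun r s t h h' => btw_low κ (btw_ord x r s t h h'))
        hi.injective_low hj.injective_low hl.injective_low]
    group
  · have h1 := (far_or_false hi hj).resolve_left hκ
    have h2 := (far_or_false hj hl).resolve_left hκ
    obtain ⟨s, _⟩ := i
    obtain ⟨t, _⟩ := j
    obtain ⟨u, _⟩ := l
    obtain ⟨rfl, rfl⟩ := h1
    obtain ⟨-, rfl⟩ := h2
    rw [good_false] at *
    simp only [coc_false]
    exact cmpFam_mul hL (btw_ord x) hi.2 hj.2 hl.2

theorem leg_comp (hi : Good κ i x) (π : Equiv.Perm (Fin (k + 1))) :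
    leg L (π⁻¹ κ) (x ∘ π) i = leg L κ x i := by
  obtain ⟨s, _ | _⟩ := i
  · have h1 := hi.injective_low
    rw [good_false] at hi
    have : (x ∘ π) (π⁻¹ κ) = x κ := by simp
    simp only [leg, Bool.false_eq_true, if_false, crossLift, this, ord_comp, low_comp]
    rw [cmpLift_comp L h1 hi.2, cmpLift_comp L hi.2 h1]
  · rfl

theorem coc_comp (hi : Good κ i x) (hj : Good κ j x) (π : Equiv.Perm (Fin (k + 1))) :
    coc L (π⁻¹ κ) (x ∘ π) i j = coc L κ x i j := by
  unfold coc
  split_ifs with h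
  · obtain ⟨s, _⟩ := i
    obtain ⟨t, _⟩ := j
    obtain ⟨rfl, rfl⟩ := h
    rw [good_false] at *
    simp only [ord_comp]
    exact cmpFam_comp L (a := fun s => ord s x) hi.2 hj.2 π
  · rw [leg_comp hi, leg_comp hj]
    congr 2
    simp only [ord_comp, low_comp]
    exact cmpFam_comp L (a := fun s => low κ (ord s x)) hi.injective_low hj.injective_low π

theorem coc_congr {κ' : Fin (k + 1)} (hi : Good κ i x) (hj : Good κ j x) (hi' : Good κ' i x)
    (hj' : Good κ' j x) : coc L κ x i j = coc L κ' x i j := by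
  by_cases h : i.2 = false ∧ j.2 = false
  · rw [coc, coc, if_pos h, if_pos h]
  · rw [((far_or_false hi hj).resolve_right h).unique ((far_or_false hi' hj').resolve_right h)]

/-! ### Local constancy -/

theorem eventually_ord_lt {s : ℝ} {a b : Fin (k + 1)} (ha : x a ≠ infc 0) (hb : x b ≠ infc 0)
    (h : ord s x a < ord s x b) : ∀ᶠ y in 𝓝 x, ord s y a < ord s y b := by
  have c {a : Fin (k + 1)} (ha : x a ≠ infc 0) : ContinuousAt (fun y => ord s y a) x :=
    (slant s).continuous.continuousAt.comp
      (ContinuousAt.comp (continuousAt_zc ha) (continuous_apply a).continuousAt)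
  exact (c ha).eventually_lt (c hb) h

theorem injective_of_lt_imp {a b : Fin (k + 1) → ℝ} (ha : Function.Injective a)
    (h : ∀ i j, a i < a j → b i < b j) : Function.Injective b := by
  intro i j e
  by_contra hne
  rcases lt_or_gt_of_ne (ha.ne hne) with h' | h'
  · exact (h _ _ h').ne e
  · exact (h _ _ h').ne' e

theorem eventually_rk_ord (hx : ∀ i, x i ≠ infc 0) {s : ℝ} (hs : Function.Injective (ord s x)) :
    ∀ᶠ y in 𝓝 x, (∀ i, y i ≠ infc 0) ∧ Function.Injective (ord s y) ∧
      rk (ord s y) = rk (ord s x) := by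
  have h1 : ∀ᶠ y in 𝓝 x, ∀ i j, ord s x i < ord s x j → ord s y i < ord s y j := by
    simp only [Filter.eventually_all]
    exact fun i j h => eventually_ord_lt (hx i) (hx j) h
  have h2 : ∀ᶠ y in 𝓝 x, ∀ i, y i ≠ infc 0 := by
    simp only [Filter.eventually_all]
    exact fun i => (continuous_apply i).continuousAt.eventually (eventually_ne_infc_zero (hx i))
  filter_upwards [h1, h2] with y h1 h2
  have h3 := injective_of_lt_imp hs h1
  exact ⟨h2, h3, (rk_congr hs h3 h1).symm⟩

theorem eventually_rk_low (hκ : Far κ x) {s : ℝ} (hs : Function.Injective (low κ (ord s x))) :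
    ∀ᶠ y in 𝓝 x, Far κ y ∧ Function.Injective (low κ (ord s y)) ∧
      rk (low κ (ord s y)) = rk (low κ (ord s x)) := by
  have h1 : ∀ᶠ y in 𝓝 x, ∀ i j, low κ (ord s x) i < low κ (ord s x) j →
      low κ (ord s y) i < low κ (ord s y) j := by
    simp only [Filter.eventually_all]
    intro i j h
    by_cases hj : j = κ
    · subst hj
      by_cases hi : i = j
      · subst hi; exact absurd h (lt_irrefl _)
      · exact absurd h (low_lt hi _).not_gt
    · by_cases hi : i = κ
      · subst hi
        exact .of_forall fun y => low_lt hj _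
      · rw [low_of_ne hi, low_of_ne hj] at h
        filter_upwards [eventually_ord_lt (hκ.ne_of_ne hi) (hκ.ne_of_ne hj) h] with y hy
        rwa [low_of_ne hi, low_of_ne hj]
  filter_upwards [h1, hκ.eventually] with y h1 h2
  have h3 := injective_of_lt_imp hs h1
  exact ⟨h2, h3, (rk_congr hs h3 h1).symm⟩

theorem Good.eventually (hi : Good κ i x) : ∀ᶠ y in 𝓝 x, Good κ i y := by
  obtain ⟨s, _ | _⟩ := i
  · rw [good_false] at hi
    filter_upwards [eventually_rk_ord hi.1 hi.2] with y hy
    exact good_false.2 ⟨hy.1, hy.2.1⟩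
  · filter_upwards [eventually_rk_low hi.1 hi.2] with y hy
    exact ⟨hy.1, hy.2.1⟩

theorem Good.injective (hi : Good κ i x) : Function.Injective x := by
  obtain ⟨s, _ | _⟩ := i
  · exact Function.Injective.of_comp (Function.Injective.of_comp (good_false.1 hi).2)
  · refine hi.1.injective fun a ha b hb e => ?_
    refine injOn_of_low hi.2 ha hb ?_
    simp [ord_apply, e]

theorem leg_eventually (hL : IsLift τ L) (hσ : ((List.range k).map (IsLift.ext τ)).prod *
      ((List.range k).reverse.map (IsLift.ext τ)).prod = 1) (hκ : Far κ x) (hi : Good κ i x) :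
    ∀ᶠ y in 𝓝 x, leg L κ y i = leg L κ x i := by
  obtain ⟨s, _ | _⟩ := i
  swap
  · exact .of_forall fun y => rfl
  have hi' := good_false.1 hi
  have c : ContinuousAt (fun y : Fin (k + 1) → CP 1 => zc (y κ)) x :=
    ContinuousAt.comp (f := fun y : Fin (k + 1) → CP 1 => y κ) (continuousAt_zc (hi'.1 κ))
      (continuous_apply κ).continuousAt
  have cr : ContinuousAt (fun y : Fin (k + 1) → CP 1 => (zc (y κ)).re) x :=
    Complex.continuous_re.continuousAt.comp c
  have ci : ContinuousAt (fun y : Fin (k + 1) → CP 1 => (zc (y κ)).im) x :=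
    Complex.continuous_im.continuousAt.comp c
  have h1 := eventually_rk_ord hi'.1 hi'.2
  have h2 := eventually_rk_low hκ hi.injective_low
  simp only [leg, Bool.false_eq_true, if_false]
  rcases lt_trichotomy (zc (x κ)).re (zc (x κ)).im with h | h | h
  · filter_upwards [h1, h2, cr.eventually_lt ci h] with y h1 h2 h3
    simp only [crossLift, if_pos h3, if_pos h, cmpLift, h1.2.2, h2.2.2]
  · have h3 : ∀ᶠ y in 𝓝 x, |(zc (y κ)).im - (zc (y κ)).re| < 1 :=
      (ci.sub cr).abs.eventually_lt continuousAt_const (by simp [h])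
    filter_upwards [h1, h2, h3] with y h1 h2 h3
    rw [crossLift_of_near_diagonal hL hσ h2.1 (h1.1 κ) h3 s.2 h1.2.1,
      crossLift_of_near_diagonal hL hσ hκ (hi'.1 κ) (by simp [h]) s.2 hi'.2]
    simp only [cmpLift, h1.2.2, h2.2.2]
  · filter_upwards [h1, h2, ci.eventually_lt cr h] with y h1 h2 h3
    simp only [crossLift, if_neg h3.not_gt, if_neg h.not_gt, cmpLift, h1.2.2, h2.2.2]

theorem coc_eventually (hL : IsLift τ L) (hσ : ((List.range k).map (IsLift.ext τ)).prod *
      ((List.range k).reverse.map (IsLift.ext τ)).prod = 1) (hi : Good κ i x) (hj : Good κ j x) :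
    ∀ᶠ y in 𝓝 x, coc L κ y i j = coc L κ x i j := by
  by_cases h : i.2 = false ∧ j.2 = false
  · obtain ⟨s, _⟩ := i
    obtain ⟨t, _⟩ := j
    obtain ⟨rfl, rfl⟩ := h
    rw [good_false] at *
    filter_upwards [eventually_rk_ord hi.1 hi.2, eventually_rk_ord hj.1 hj.2] with y h1 h2
    simp only [coc_false]
    exact cmpFam_congr L h1.2.2 h2.2.2
  · have hκ := (far_or_false hi hj).resolve_right h
    filter_upwards [eventually_rk_low hκ hi.injective_low, eventually_rk_low hκ hj.injective_low,
      leg_eventually hL hσ hκ hi, leg_eventually hL hσ hκ hj] with y h1 h2 h3 h4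
    rw [coc, coc, if_neg h, if_neg h, h3, h4]
    congr 2
    exact cmpFam_congr L h1.2.2 h2.2.2

theorem ord_base (s : ℝ) : ord s (aff ∘ baseTuple (k := k)) = basePos := by
  rw [← slant_comp_baseTuple s]; ext; simp [ord]

theorem coc_base (hL : IsLift τ L) : coc L 0 (aff ∘ baseTuple) i j = 1 := by
  have h := rk_low (k := k) (κ := 0) strictMono_basePos.injective
    fun i hi => strictMono_basePos (Fin.pos_iff_ne_zero.2 hi)
  simp only [coc, leg, crossLift, cmpFam, cmpLift, ord_base, h, mul_inv_cancel, hL.one, inv_one,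
    ite_self, mul_one]

theorem Good.of_false {κ' : Fin (k + 1)} (h : Good κ i x) (h' : i.2 = false) : Good κ' i x := by
  obtain ⟨s, _⟩ := i
  subst h'
  exact good_false.2 (good_false.1 h)

/-! ### The monodromy -/

variable [NeZero k]

theorem Good.mem_chart (h : Good κ i x) : cfg x ∈ chart i := by
  have hx := h.injective
  obtain ⟨s, _ | _⟩ := i
  · exact (mem_chartW hx).2 (good_false.1 h)
  · exact (mem_chartV hx).2 ⟨κ, h⟩

theorem mem_chart_iff (hx : Function.Injective x) : cfg x ∈ chart i ↔ ∃ κ, Good κ i x := by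
  refine ⟨fun h => ?_, fun ⟨κ, h⟩ => h.mem_chart⟩
  obtain ⟨s, _ | _⟩ := i
  · exact ⟨0, good_false.2 ((mem_chartW hx).1 h)⟩
  · exact (mem_chartV hx).1 h

theorem exists_good {T : Set (I × Bool)} (hx : Function.Injective x)
    (hT : ∀ i ∈ T, cfg x ∈ chart i) : ∃ κ, ∀ i ∈ T, Good κ i x := by
  by_cases h : ∃ κ, Far κ x
  · obtain ⟨κ, hκ⟩ := h
    refine ⟨κ, fun i hi => ?_⟩
    obtain ⟨κ', h'⟩ := (mem_chart_iff hx).1 (hT i hi)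
    by_cases hb : i.2 = false
    · exact h'.of_false hb
    · obtain ⟨s, _ | _⟩ := i
      · exact absurd rfl hb
      · rwa [hκ.unique h'.1]
  · refine ⟨0, fun i hi => ?_⟩
    obtain ⟨κ', h'⟩ := (mem_chart_iff hx).1 (hT i hi)
    obtain ⟨s, _ | _⟩ := i
    · exact h'.of_false rfl
    · exact absurd ⟨κ', h'.1⟩ h

open Classical in
/-- The cocycle of the braid covering. -/
def braidCocycle (L : Equiv.Perm (Fin (k + 1)) → G) (i j : I × Bool) (c : Conf k) : G :=
  if h : ∃ p : Fin (k + 1) × (Fin (k + 1) → CP 1), cfg p.2 = c ∧ Good p.1 i p.2 ∧ Good p.1 j p.2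
  then coc L h.choose.1 h.choose.2 i j else 1

theorem braidCocycle_cfg (hi : Good κ i x) (hj : Good κ j x) :
    braidCocycle L i j (cfg x) = coc L κ x i j := by
  have h : ∃ p : Fin (k + 1) × (Fin (k + 1) → CP 1), cfg p.2 = cfg x ∧ Good p.1 i p.2 ∧
    Good p.1 j p.2 := ⟨(κ, x), rfl, hi, hj⟩
  rw [braidCocycle, dif_pos h]
  obtain ⟨h1, h2, h3⟩ := h.choose_spec
  obtain ⟨π, hπ⟩ := (cfg_eq_iff h2.injective hi.injective).1 h1
  rw [← coc_comp h2 h3 π]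
  have h4 := h2.comp π
  have h5 := h3.comp π
  rw [← hπ] at h4 h5 ⊢
  exact coc_congr h4 h5 hi hj

theorem eventually_nhds_cfg (hi : Good κ i x) {P : Conf k → Prop}
    (h : ∀ᶠ y in 𝓝 x, P (cfg y)) : ∀ᶠ c in 𝓝 (cfg x), P c := by
  obtain ⟨U, hU, hUo, hxU⟩ := eventually_nhds_iff.1 (h.and hi.eventually)
  have : IsOpen (cfg '' U) := isOpen_image_cfg hUo fun y hy => (hU y hy).2.injective
  filter_upwards [this.mem_nhds (mem_image_of_mem _ hxU)]
  rintro _ ⟨y, hy, rfl⟩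
  exact (hU y hy).1

theorem exists_braid_monodromy (hL : IsLift τ L) (hσ : ((List.range k).map (IsLift.ext τ)).prod *
      ((List.range k).reverse.map (IsLift.ext τ)).prod = 1) :
    ∃ (E : Type u) (T : FundamentalGroup (Conf k) (cover k).base →* Equiv.Perm E) (e : G → E),
      Function.Injective e ∧ ∀ i j c (hi : c ∈ (cover k).carrier i) (hj : c ∈ (cover k).carrier j)
        (h : G), T ((cover k).loop i j hi hj) (e h) = e (braidCocycle L i j c * h) := by
  refine (cover k).exists_monodromy (braidCocycle L) (fun i j c hc => ?_)
    (fun i j l c hi hj hl => ?_) fun i j => ?_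
  · obtain ⟨x, hx, rfl⟩ := exists_cfg_eq c
    obtain ⟨κ, hκ⟩ := exists_good (T := {i, j}) hx (by
      rintro l (rfl | rfl)
      exacts [hc.1, hc.2])
    have hi := hκ i (by simp)
    have hj := hκ j (by simp)
    refine eventually_nhds_cfg hi ?_
    filter_upwards [coc_eventually hL hσ hi hj, hi.eventually, hj.eventually] with y h1 h2 h3
    rw [braidCocycle_cfg h2 h3, braidCocycle_cfg hi hj, h1]
  · obtain ⟨x, hx, rfl⟩ := exists_cfg_eq c
    obtain ⟨κ, hκ⟩ := exists_good (T := {i, j, l}) hx (by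
      rintro l (rfl | rfl | rfl)
      exacts [hi, hj, hl])
    have hi := hκ i (by simp)
    have hj := hκ j (by simp)
    have hl := hκ l (by simp)
    rw [braidCocycle_cfg hi hj, braidCocycle_cfg hj hl, braidCocycle_cfg hi hl]
    exact coc_mul hL hi hj hl
  · have h (i : I × Bool) : Good 0 i (aff ∘ baseTuple (k := k)) := by
      obtain ⟨s, _ | _⟩ := i
      · refine good_false.2 ⟨fun i => aff_ne_infc_zero _, ?_⟩
        rw [ord_base]
        exact strictMono_basePos.injective
      · refine ⟨far_baseTuple, low_injective ?_⟩
        rw [ord_base]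
        exact strictMono_basePos.injective.injOn
    exact (braidCocycle_cfg (h i) (h j)).trans (coc_base hL)

end SphereConf

end

section

open Set Topology unitInterval

namespace SphereConf

open ArtinLift

variable {k : ℕ}

/-! ### Orders on linear families -/

theorem rk_eq_of_lt {a : Fin (k + 1) → ℝ} {r : Equiv.Perm (Fin (k + 1))}
    (h : ∀ i j, r i < r j → a i < a j) : Function.Injective a ∧ rk a = r := by
  have ha : Function.Injective a := by
    intro i j e
    by_contra hne
    rcases lt_or_gt_of_ne (r.injective.ne hne) with h' | h'
    · exact (h _ _ h').ne e
    · exact (h _ _ h').ne' e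
  refine ⟨ha, rk_unique ha fun i j hij => ?_⟩
  by_contra h'
  rcases (not_lt.1 h').lt_or_eq with h'' | h''
  · exact lt_asymm hij (h _ _ h'')
  · rw [r.injective h''] at hij
    exact lt_irrefl _ hij

theorem exists_dominant {a : Fin (k + 1) → ℝ} (ha : Function.Injective a)
    (d : Fin (k + 1) → ℝ) : ∃ K > 0, Function.Injective (fun i => K * a i + d i) ∧
      rk (fun i => K * a i + d i) = rk a := by
  have h : ∀ᶠ K : ℝ in Filter.atTop, ∀ i j, a i < a j → K * a i + d i < K * a j + d j := by
    simp only [Filter.eventually_all]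
    intro i j hij
    filter_upwards [Filter.eventually_gt_atTop ((d i - d j) / (a j - a i))] with K hK
    rw [div_lt_iff₀ (sub_pos.2 hij)] at hK
    linarith
  obtain ⟨K, h1, h2⟩ := (h.and (Filter.eventually_gt_atTop 0)).exists
  have h3 := injective_of_lt_imp ha h1
  exact ⟨K, h2, h3, (rk_congr ha h3 h1).symm⟩

theorem rk_const_mul {a : Fin (k + 1) → ℝ} (ha : Function.Injective a) {K : ℝ} (hK : 0 < K) :
    Function.Injective (fun i => K * a i) ∧ rk (fun i => K * a i) = rk a := by
  have h1 (i j) (h : a i < a j) : K * a i < K * a j := mul_lt_mul_of_pos_left h hK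
  have h3 := injective_of_lt_imp ha h1
  exact ⟨h3, (rk_congr ha h3 h1).symm⟩

/-- The tuple of complex numbers with prescribed values of `slant s` and `slant t`. -/
def line (s t : ℝ) (a b : Fin (k + 1) → ℝ) (j : Fin (k + 1)) : ℂ :=
  ⟨a j - s / (t - s) * (b j - a j), a j + (1 - s) / (t - s) * (b j - a j)⟩

theorem slant_line {s t : ℝ} (r : ℝ) (a b : Fin (k + 1) → ℝ) (j : Fin (k + 1)) :
    slant r (line s t a b j) = a j + (r - s) / (t - s) * (b j - a j) := by
  simp only [slant_apply, line]
  ring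

theorem slant_line_left {s t : ℝ} (a b : Fin (k + 1) → ℝ) :
    slant s ∘ line s t a b = a := by
  ext j; simp [slant_line]

theorem slant_line_right {s t : ℝ} (h : s < t) (a b : Fin (k + 1) → ℝ) :
    slant t ∘ line s t a b = b := by
  ext j
  rw [Function.comp_apply, slant_line, div_self (sub_pos.2 h).ne']
  ring

theorem rk_of_strictMono {a : Fin (k + 1) → ℝ} (ha : StrictMono a) : rk a = 1 :=
  (rk_eq_of_lt fun i j h => ha (by simpa using h)).2

/-- The tuple `0, 1, …, k` of real numbers. -/
def stdPos (j : Fin (k + 1)) : ℝ := (j : ℕ)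

theorem strictMono_stdPos : StrictMono (stdPos (k := k)) := fun _ _ h => Nat.cast_lt.2 h

theorem rk_stdPos_comp (w : Equiv.Perm (Fin (k + 1))) : rk (stdPos ∘ w) = w := by
  rw [rk_comp strictMono_stdPos.injective, rk_of_strictMono strictMono_stdPos, one_mul]

/-- Increasing positions with large gaps, except for a small one after `i`. -/
def gapPos (i : Fin k) (j : Fin (k + 1)) : ℝ :=
  (k + 1) * (j : ℕ) - if (i : ℕ) < j then (k : ℝ) + 3 / 4 else 0

theorem ord_aff (s : ℝ) (z : Fin (k + 1) → ℂ) : ord s (aff ∘ z) = slant s ∘ z := by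
  ext; simp [ord]

theorem good_aff {κ : Fin (k + 1)} {s : I} {z : Fin (k + 1) → ℂ}
    (h : Function.Injective (slant s ∘ z)) :
    Good κ (s, false) (aff ∘ z) :=
  good_false.2 ⟨fun _ => aff_ne_infc_zero _, by rwa [ord_aff]⟩

/-! ### Transition loops -/

variable [NeZero k]

open Classical in
/-- The transition loop between two charts at a configuration. -/
def trans (i j : I × Bool) (c : Conf k) : FundamentalGroup (Conf k) (cover k).base :=
  if h : c ∈ (cover k).carrier i ∧ c ∈ (cover k).carrier j then (cover k).loop i j h.1 h.2 else 1

variable {i j l : I × Bool} {c : Conf k} {κ : Fin (k + 1)} {x : Fin (k + 1) → CP 1}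

theorem trans_eq (hi : c ∈ (cover k).carrier i) (hj : c ∈ (cover k).carrier j) :
    trans i j c = (cover k).loop i j hi hj := dif_pos ⟨hi, hj⟩

theorem trans_mul (hi : c ∈ chart i) (hj : c ∈ chart j) (hl : c ∈ chart l) :
    trans i j c * trans j l c = trans i l c := by
  rw [trans_eq hi hj, trans_eq hj hl, trans_eq hi hl]
  exact (cover k).loop_mul_loop hi hj hl

theorem trans_inv (hi : c ∈ chart i) (hj : c ∈ chart j) :
    (trans i j c)⁻¹ = trans j i c := by
  rw [trans_eq hi hj, trans_eq hj hi]
  exact (cover k).loop_inv hi hj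

theorem trans_base : trans i j (cfg (aff ∘ baseTuple (k := k))) = 1 :=
  (trans_eq ((cover k).base_mem i) ((cover k).base_mem j)).trans ((cover k).loop_base i j)

theorem trans_eq_of_curve {γ : ℝ → Fin (k + 1) → CP 1} (hγ : ContinuousOn γ I)
    (hi : ∀ u ∈ I, Good κ i (γ u)) (hj : ∀ u ∈ I, Good κ j (γ u)) :
    trans i j (cfg (γ 0)) = trans i j (cfg (γ 1)) := by
  have h0 : (0 : ℝ) ∈ I := ⟨le_rfl, zero_le_one⟩
  have h1 : (1 : ℝ) ∈ I := ⟨zero_le_one, le_rfl⟩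
  have hc : ContinuousOn (fun u => cfg (γ u)) I :=
    continuousOn_cfg.comp hγ fun u hu => (hi u hu).injective
  rw [trans_eq (hi 0 h0).mem_chart (hj 0 h0).mem_chart,
    trans_eq (hi 1 h1).mem_chart (hj 1 h1).mem_chart]
  refine (cover k).loop_eq_of_joinedIn (JoinedIn.ofLine hc rfl rfl ?_) _ _ _ _
  rintro _ ⟨u, hu, rfl⟩
  exact ⟨(hi u hu).mem_chart, (hj u hu).mem_chart⟩

theorem mem_chart_aff {s : I} {z : Fin (k + 1) → ℂ} (h : Function.Injective (slant s ∘ z)) :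
    cfg (aff ∘ z) ∈ chart (s, false) := (good_aff (κ := 0) h).mem_chart

theorem trans_congr {s t : I} {z z' : Fin (k + 1) → ℂ} (hs : Function.Injective (slant s ∘ z))
    (hs' : Function.Injective (slant s ∘ z')) (ht : Function.Injective (slant t ∘ z))
    (ht' : Function.Injective (slant t ∘ z')) (rs : rk (slant s ∘ z) = rk (slant s ∘ z'))
    (rt : rk (slant t ∘ z) = rk (slant t ∘ z')) :
    trans (s, false) (t, false) (cfg (aff ∘ z)) = trans (s, false) (t, false) (cfg (aff ∘ z')) := by
  let γ : ℝ → Fin (k + 1) → CP 1 := fun u => aff ∘ ((1 - u) • z + u • z')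
  have hγ : Continuous γ := by
    refine continuous_pi fun i => isOpenEmbedding_aff.continuous.comp ?_
    simp only [Pi.add_apply, Pi.smul_apply]
    fun_prop
  have key {s : I} (hs : Function.Injective (slant s ∘ z))
      (hs' : Function.Injective (slant s ∘ z')) (rs : rk (slant s ∘ z) = rk (slant s ∘ z'))
      (u : ℝ) (hu : u ∈ I) : Good 0 (s, false) (γ u) := by
    refine good_aff (injective_of_lt_imp hs fun i j h => ?_)
    have h' : slant s (z' i) < slant s (z' j) := (rk_lt_rk hs').1 (rs ▸ (rk_lt_rk hs).2 h)
    simp only [Function.comp_apply, Pi.add_apply, Pi.smul_apply, map_add, map_smul,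
      smul_eq_mul] at h ⊢
    obtain ⟨h0, h1⟩ := hu
    rcases h0.eq_or_lt with rfl | h0
    · simpa using h
    · have := mul_lt_mul_of_pos_left h' h0
      have := mul_le_mul_of_nonneg_left h.le (sub_nonneg.2 h1)
      linarith
  have h0 : γ 0 = aff ∘ z := by simp [γ]
  have h1 : γ 1 = aff ∘ z' := by simp [γ]
  rw [← h0, ← h1]
  exact trans_eq_of_curve hγ.continuousOn (key hs hs' rs) (key ht ht' rt)

theorem trans_comp (x : Fin (k + 1) → CP 1) (π : Equiv.Perm (Fin (k + 1))) :
    trans i j (cfg (x ∘ π)) = trans i j (cfg x) := by rw [cfg_comp]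

theorem trans_eq_one {s t : I} {z : Fin (k + 1) → ℂ} (hs : Function.Injective (slant s ∘ z))
    (ht : Function.Injective (slant t ∘ z)) (h : rk (slant s ∘ z) = rk (slant t ∘ z)) :
    trans (s, false) (t, false) (cfg (aff ∘ z)) = 1 := by
  set π := rk (slant s ∘ z) with hπ
  have h1 (r : ℝ) : slant r ∘ baseTuple ∘ π = basePos ∘ π := by
    rw [← Function.comp_assoc, slant_comp_baseTuple]
  have h2 (r : ℝ) : Function.Injective (slant r ∘ baseTuple ∘ π) := by
    rw [h1]; exact strictMono_basePos.injective.comp π.injective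
  have h3 (r : ℝ) : rk (slant r ∘ baseTuple ∘ π) = π := by
    rw [h1, rk_comp strictMono_basePos.injective, rk_of_strictMono strictMono_basePos, one_mul]
  rw [trans_congr hs (h2 s) ht (h2 t) (by rw [h3]) (by rw [h3, h]), ← Function.comp_assoc,
    trans_comp, trans_base]

/-- The transition from `slant 0` to `slant 1`. -/
def stdTrans (a b : Fin (k + 1) → ℝ) : FundamentalGroup (Conf k) (cover k).base :=
  trans (0, false) (1, false) (cfg (aff ∘ line 0 1 a b))

theorem trans_eq_stdTrans {s t : I} (hst : s < t) {z : Fin (k + 1) → ℂ}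
    (hs : Function.Injective (slant s ∘ z)) (ht : Function.Injective (slant t ∘ z)) :
    trans (s, false) (t, false) (cfg (aff ∘ z)) = stdTrans (slant s ∘ z) (slant t ∘ z) := by
  set a := slant s ∘ z with ha
  set b := slant t ∘ z with hb
  have hst' : (s : ℝ) < t := hst
  have hs0 : (0 : ℝ) ≤ s := s.2.1
  have ht1 : (t : ℝ) ≤ 1 := t.2.2
  have ht0 : (0 : ℝ) < t := hs0.trans_lt hst'
  have hd : 0 < (t : ℝ) - s := sub_pos.2 hst'
  obtain ⟨K, hK, hKi, hKr⟩ := exists_dominant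
    (rk_const_mul hs (K := 1 + s / (t - s)) (by positivity)).1 fun i => -(s / (t - s)) * b i
  obtain ⟨hai, har⟩ := rk_const_mul hs hK
  have h1s : slant s ∘ line s t (fun i => K * a i) b = fun i => K * a i := slant_line_left _ _
  have h1t : slant t ∘ line s t (fun i => K * a i) b = b := slant_line_right hst' _ _
  have h10 : slant ((0 : I) : ℝ) ∘ line s t (fun i => K * a i) b =
      fun i => K * ((1 + s / (t - s)) * a i) + -(s / (t - s)) * b i := by
    ext i
    rw [Function.comp_apply, slant_line, Set.Icc.coe_zero]
    ring
  have hr0 := hKr.trans (rk_const_mul hs (K := 1 + s / ((t : ℝ) - s)) (by positivity)).2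
  rw [trans_congr hs (by rwa [h1s]) ht (by rwa [h1t]) (by rw [h1s, har]) (by rw [h1t]),
    ← trans_mul (j := (0, false)) (mem_chart_aff (by rwa [h1s]))
      (mem_chart_aff (by rwa [h10])) (mem_chart_aff (by rwa [h1t])),
    trans_eq_one (by rwa [h1s]) (by rwa [h10]) (by rw [h1s, h10, har, hr0]), one_mul]
  obtain ⟨N, hN, hNi, hNr⟩ := exists_dominant
    (rk_const_mul ht (K := 1 / t) (by positivity)).1 fun i => (1 - 1 / t) * a i
  have hr1 := hNr.trans (rk_const_mul ht (K := 1 / (t : ℝ)) (by positivity)).2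
  obtain ⟨hbi, hbr⟩ := rk_const_mul ht hN
  have h20 : slant ((0 : I) : ℝ) ∘ line (0 : I) t a (fun i => N * b i) = a := slant_line_left _ _
  have h2t : slant t ∘ line (0 : I) t a (fun i => N * b i) = fun i => N * b i :=
    slant_line_right ht0 _ _
  have h21 : slant ((1 : I) : ℝ) ∘ line (0 : I) t a (fun i => N * b i) =
      fun i => N * (1 / t * b i) + (1 - 1 / t) * a i := by
    ext i
    rw [Function.comp_apply, slant_line, Set.Icc.coe_zero, Set.Icc.coe_one]
    ring
  have h30 : slant ((0 : I) : ℝ) ∘ line 0 1 a b = a := slant_line_left a b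
  have h31 : slant ((1 : I) : ℝ) ∘ line 0 1 a b = b := slant_line_right one_pos a b
  rw [trans_congr (z' := line (0 : I) t a (fun i => N * b i)) (by rwa [h10]) (by rwa [h20])
    (by rwa [h1t]) (by rwa [h2t]) (by rw [h10, h20, hr0]) (by rw [h1t, h2t, hbr]),
    ← trans_mul (j := (1, false)) (mem_chart_aff (by rwa [h20]))
      (mem_chart_aff (by rwa [h21])) (mem_chart_aff (by rwa [h2t])),
    trans_eq_one (s := 1) (t := t) (by rwa [h21]) (by rwa [h2t]) (by rw [h21, h2t, hr1, hbr]),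
    mul_one]
  exact trans_congr (by rwa [h20]) (by rwa [h30]) (by rwa [h21]) (by rwa [h31])
    (by rw [h20, h30]) (by rw [h21, h31, hr1])

/-- The braid in which the strands are permuted by `w`, any two crossing at most once. -/
def permBraid (w : Equiv.Perm (Fin (k + 1))) : FundamentalGroup (Conf k) (cover k).base :=
  stdTrans (stdPos ∘ w) stdPos

theorem stdTrans_congr {a b a' b' : Fin (k + 1) → ℝ} (ha : Function.Injective a)
    (hb : Function.Injective b) (ha' : Function.Injective a') (hb' : Function.Injective b')
    (h : rk a = rk a') (h' : rk b = rk b') : stdTrans a b = stdTrans a' b' := by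
  have h0 (a b : Fin (k + 1) → ℝ) : slant ((0 : I) : ℝ) ∘ line 0 1 a b = a := slant_line_left a b
  have h1 (a b : Fin (k + 1) → ℝ) : slant ((1 : I) : ℝ) ∘ line 0 1 a b = b :=
    slant_line_right one_pos a b
  exact trans_congr (by rwa [h0]) (by rwa [h0]) (by rwa [h1]) (by rwa [h1]) (by rwa [h0, h0])
    (by rwa [h1, h1])

theorem stdTrans_eq {a b : Fin (k + 1) → ℝ} (ha : Function.Injective a)
    (hb : Function.Injective b) : stdTrans a b = cmpLift permBraid a b := by
  set w := rk a * (rk b)⁻¹ with hw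
  have h := (strictMono_stdPos (k := k)).injective
  have e : stdTrans a b = stdTrans ((stdPos ∘ w) ∘ rk b) (stdPos ∘ rk b) := by
    refine stdTrans_congr ha hb ((h.comp w.injective).comp (rk b).injective)
      (h.comp (rk b).injective) ?_ ?_
    · rw [Function.comp_assoc, ← Equiv.Perm.coe_mul, rk_stdPos_comp, hw, inv_mul_cancel_right]
    · rw [rk_stdPos_comp]
  have e' : aff ∘ line 0 1 ((stdPos ∘ w) ∘ rk b) (stdPos ∘ rk b) =
      (aff ∘ line 0 1 (stdPos ∘ w) stdPos) ∘ rk b := rfl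
  rw [e, stdTrans, e', trans_comp]
  rfl

theorem trans_eq_cmpLift {s t : I} (hst : s < t) {z : Fin (k + 1) → ℂ}
    (hs : Function.Injective (slant s ∘ z)) (ht : Function.Injective (slant t ∘ z)) :
    trans (s, false) (t, false) (cfg (aff ∘ z)) =
      cmpLift permBraid (slant s ∘ z) (slant t ∘ z) :=
  (trans_eq_stdTrans hst hs ht).trans (stdTrans_eq hs ht)

theorem permBraid_one : permBraid (1 : Equiv.Perm (Fin (k + 1))) = 1 := by
  have h := (strictMono_stdPos (k := k)).injective
  have h0 : slant ((0 : I) : ℝ) ∘ line 0 1 (stdPos (k := k)) stdPos = stdPos :=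
    slant_line_left _ _
  have h1 : slant ((1 : I) : ℝ) ∘ line 0 1 (stdPos (k := k)) stdPos = stdPos :=
    slant_line_right one_pos _ _
  rw [permBraid, Equiv.Perm.coe_one, Function.comp_id]
  exact trans_eq_one (by rwa [h0]) (by rwa [h1]) (by rw [h0, h1])

theorem isLift_permBraid :
    IsLift (fun i => permBraid (adjSwap i)) (permBraid (k := k)) := by
  refine ⟨permBraid_one, fun w i hw => ?_⟩
  let a : Fin (k + 1) → ℝ := stdPos ∘ w
  have ha : Function.Injective a ∧ rk a = w :=
    ⟨strictMono_stdPos.injective.comp w.injective, rk_stdPos_comp w⟩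
  have bound (j : Fin (k + 1)) : 0 ≤ a j ∧ a j ≤ k :=
    ⟨Nat.cast_nonneg _, Nat.cast_le.2 (Nat.lt_succ_iff.1 (w j).2)⟩
  have hi : a i.castSucc + 1 ≤ a i.succ := by
    have : (w i.castSucc : ℕ) + 1 ≤ w i.succ := hw
    simp only [a, stdPos, Function.comp_apply]
    exact_mod_cast this
  have gap (p q : Fin (k + 1)) (h : p < q) (hpq : ¬ (p = i.castSucc ∧ q = i.succ)) :
      gapPos i p + (k + 1) ≤ gapPos i q := by
    have h' : (p : ℕ) < q := h
    have hpq' : ¬ ((p : ℕ) = i ∧ (q : ℕ) = i + 1) := by simpa [Fin.ext_iff] using hpq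
    have hk : (0 : ℝ) ≤ k := Nat.cast_nonneg k
    unfold gapPos
    by_cases h1 : (i : ℕ) < p
    · have h3 : ((p : ℕ) : ℝ) + 1 ≤ (q : ℕ) := by exact_mod_cast h'
      rw [if_pos h1, if_pos (h1.trans h')]
      nlinarith
    · by_cases h2 : (i : ℕ) < q
      · have h3 : (p : ℕ) + 2 ≤ q := by omega
        have h3 : ((p : ℕ) : ℝ) + 2 ≤ (q : ℕ) := by exact_mod_cast h3
        rw [if_neg h1, if_pos h2]
        nlinarith
      · have h3 : ((p : ℕ) : ℝ) + 1 ≤ (q : ℕ) := by exact_mod_cast h'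
        rw [if_neg h1, if_neg h2]
        nlinarith
  have small : gapPos i i.succ = gapPos i i.castSucc + 1 / 4 := by
    simp only [gapPos, Fin.val_succ, Fin.val_castSucc, lt_irrefl, if_false, Nat.lt_succ_self,
      if_true]
    push_cast
    ring
  have hb : Function.Injective (gapPos i) ∧ rk (gapPos i) = 1 := by
    refine rk_eq_of_lt fun p q h => ?_
    by_cases hpq : p = i.castSucc ∧ q = i.succ
    · rw [hpq.1, hpq.2, small]; linarith
    · have := gap p q h hpq
      have : (0 : ℝ) ≤ k := Nat.cast_nonneg k
      linarith
  have hc : Function.Injective (fun j => 2 * gapPos i j - a j) ∧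
      rk (fun j => 2 * gapPos i j - a j) = adjSwap i := by
    refine rk_eq_of_lt fun p q h => ?_
    by_cases hqp : q = i.castSucc ∧ p = i.succ
    · rw [hqp.1, hqp.2, small]; linarith
    · have h' : p < q ∧ ¬ (p = i.castSucc ∧ q = i.succ) := by
        have h1 : ((adjSwap i p : Fin (k + 1)) : ℕ) < adjSwap i q := h
        rw [val_adjSwap, val_adjSwap] at h1
        have h2 : ¬ ((q : ℕ) = i ∧ (p : ℕ) = i + 1) := by simpa [Fin.ext_iff] using hqp
        constructor
        · rw [Fin.lt_def]
          split_ifs at h1 <;> omega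
        · rintro ⟨rfl, rfl⟩
          simp at h1
      have := gap p q h'.1 h'.2
      have := bound p
      have := bound q
      linarith
  let h : I := ⟨1 / 2, by norm_num, by norm_num⟩
  let z : Fin (k + 1) → ℂ := fun j => ⟨a j, 2 * gapPos i j - a j⟩
  have z0 : slant ((0 : I) : ℝ) ∘ z = a := by ext j; simp [slant_apply, z]
  have z1 : slant ((1 : I) : ℝ) ∘ z = fun j => 2 * gapPos i j - a j := by
    ext j; simp [slant_apply, z]
  have zh : slant (h : ℝ) ∘ z = gapPos i := by
    ext j; simp only [Function.comp_apply, slant_apply, z, h]; ring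
  have i0 : Function.Injective (slant ((0 : I) : ℝ) ∘ z) := by rw [z0]; exact ha.1
  have i1 : Function.Injective (slant ((1 : I) : ℝ) ∘ z) := by rw [z1]; exact hc.1
  have ih : Function.Injective (slant (h : ℝ) ∘ z) := by rw [zh]; exact hb.1
  have h0h : (0 : I) < h := by rw [← Subtype.coe_lt_coe]; norm_num [h]
  have hh1 : h < 1 := by rw [← Subtype.coe_lt_coe]; norm_num [h]
  have key := trans_mul (mem_chart_aff i0) (mem_chart_aff ih) (mem_chart_aff i1)
  rw [trans_eq_cmpLift h0h i0 ih, trans_eq_cmpLift hh1 ih i1,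
    trans_eq_cmpLift (h0h.trans hh1) i0 i1,
    z0, zh, z1, cmpLift, cmpLift, cmpLift, hb.2, hc.2, ha.2] at key
  simpa [adjSwap, Equiv.swap_inv] using key.symm

end SphereConf

end

section

open Set Topology unitInterval

namespace SphereConf

open ArtinLift

variable {k : ℕ}

/-! ### The sphere relation -/

/-- The points `1 + i, …, k + k i` together with an extra point `p`. -/
def addPoint (p : ℂ) : Fin (k + 1) → ℂ :=
  Fin.cons p fun j : Fin k => ⟨(j : ℕ) + 1, (j : ℕ) + 1⟩

/-- A distance beyond which the extra point of `addPoint` is far. -/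
def farDist (k : ℕ) : ℝ := 9 * (2 + 2 * k)

theorem addPoint_zero (p : ℂ) : addPoint (k := k) p 0 = p := rfl

theorem slant_addPoint_succ (s : ℝ) (p : ℂ) (j : Fin k) :
    slant s (addPoint p j.succ) = (j : ℕ) + 1 := by
  simp only [slant_apply, addPoint, Fin.cons_succ]
  ring

theorem norm_addPoint_succ (p : ℂ) (j : Fin k) : ‖addPoint p j.succ‖ ≤ 2 * k := by
  have h : ((j : ℕ) : ℝ) + 1 ≤ k := by exact_mod_cast j.2
  have h' : (0 : ℝ) ≤ (j : ℕ) + 1 := by positivity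
  refine (Complex.norm_le_abs_re_add_abs_im _).trans ?_
  simp only [addPoint, Fin.cons_succ, abs_of_nonneg h']
  linarith

theorem far_addPoint {p : ℂ} (hp : farDist k ≤ ‖p‖) : Far 0 (aff ∘ addPoint (k := k) p) := by
  have hk : (0 : ℝ) ≤ k := Nat.cast_nonneg k
  refine far_of_lt (fun i => aff_ne_infc_zero _) ?_ fun i hi => ?_
  · simp only [Function.comp_apply, zc_aff, addPoint_zero]
    rintro rfl
    rw [norm_zero, farDist] at hp
    linarith
  · obtain ⟨j, rfl⟩ := Fin.exists_succ_eq.2 hi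
    simp only [Function.comp_apply, zc_aff, addPoint_zero]
    have := norm_addPoint_succ p j
    unfold farDist at hp
    linarith

theorem injOn_slant_addPoint (s : ℝ) (p : ℂ) :
    InjOn (slant s ∘ addPoint (k := k) p) {0}ᶜ := by
  intro a ha b hb e
  obtain ⟨a, rfl⟩ := Fin.exists_succ_eq.2 ha
  obtain ⟨b, rfl⟩ := Fin.exists_succ_eq.2 hb
  simp only [Function.comp_apply, slant_addPoint_succ, add_left_inj, Nat.cast_inj] at e
  rw [Fin.ext e]

theorem good_true_addPoint (s : I) {p : ℂ} (hp : farDist k ≤ ‖p‖) :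
    Good 0 (s, true) (aff ∘ addPoint (k := k) p) :=
  good_true.2 ⟨far_addPoint hp, low_injective (by rw [ord_aff]; exact injOn_slant_addPoint _ _)⟩

theorem slant_addPoint_mem (s : ℝ) (p : ℂ) (i : Fin (k + 1)) (hi : i ≠ 0) :
    0 < slant s (addPoint p i) ∧ slant s (addPoint p i) < farDist k := by
  obtain ⟨j, rfl⟩ := Fin.exists_succ_eq.2 hi
  rw [slant_addPoint_succ, farDist]
  have h : ((j : ℕ) : ℝ) + 1 ≤ k := by exact_mod_cast j.2
  constructor
  · positivity
  · linarith [(Nat.cast_nonneg k : (0 : ℝ) ≤ k)]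

theorem injective_slant_addPoint {s : ℝ} {p : ℂ} (hp : farDist k ≤ |slant s p|) :
    Function.Injective (slant s ∘ addPoint (k := k) p) := by
  have key (i : Fin (k + 1)) (hi : i ≠ 0) :
      slant s (addPoint p i) ≠ slant s (addPoint (k := k) p 0) := by
    have := slant_addPoint_mem s p i hi
    rw [addPoint_zero]
    rcases le_abs'.1 hp with h | h
    · exact (by linarith : slant s p < slant s (addPoint p i)).ne'
    · exact (by linarith : slant s (addPoint p i) < slant s p).ne
  intro a b e
  by_cases ha : a = 0
  · by_contra hne
    subst ha
    exact key b (Ne.symm hne) e.symm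
  · by_cases hb : b = 0
    · subst hb
      exact absurd e (key a ha)
    · exact injOn_slant_addPoint s p ha hb e

theorem good_false_addPoint {s : I} {p : ℂ} (hp : farDist k ≤ |slant s p|) :
    Good 0 (s, false) (aff ∘ addPoint (k := k) p) := good_aff (injective_slant_addPoint hp)

theorem farDist_pos : 0 < farDist k := by unfold farDist; positivity

theorem rk_slant_addPoint_of_neg {s t : ℝ} {p q : ℂ} (hp : slant s p ≤ -farDist k)
    (hq : slant t q ≤ -farDist k) :
    rk (slant s ∘ addPoint (k := k) p) = rk (slant t ∘ addPoint q) := by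
  have h0 := farDist_pos (k := k)
  refine rk_congr (injective_slant_addPoint (le_abs'.2 (.inl hp)))
    (injective_slant_addPoint (le_abs'.2 (.inl hq))) fun a b hab => ?_
  simp only [Function.comp_apply] at *
  by_cases hb : b = 0
  · subst hb
    by_cases ha : a = 0
    · subst ha
      exact absurd hab (lt_irrefl _)
    · have := slant_addPoint_mem s p a ha
      rw [addPoint_zero] at hab
      linarith
  · by_cases ha : a = 0
    · subst ha
      have := slant_addPoint_mem t q b hb
      rw [addPoint_zero]
      linarith
    · obtain ⟨a, rfl⟩ := Fin.exists_succ_eq.2 ha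
      obtain ⟨b, rfl⟩ := Fin.exists_succ_eq.2 hb
      simpa only [slant_addPoint_succ] using hab

theorem rk_slant_addPoint_of_pos {s t : ℝ} {p q : ℂ} (hp : farDist k ≤ slant s p)
    (hq : farDist k ≤ slant t q) :
    rk (slant s ∘ addPoint (k := k) p) = rk (slant t ∘ addPoint q) := by
  refine rk_congr (injective_slant_addPoint (le_abs'.2 (.inr hp)))
    (injective_slant_addPoint (le_abs'.2 (.inr hq))) fun a b hab => ?_
  simp only [Function.comp_apply] at *
  by_cases ha : a = 0
  · subst ha
    by_cases hb : b = 0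
    · subst hb
      exact absurd hab (lt_irrefl _)
    · have := slant_addPoint_mem s p b hb
      rw [addPoint_zero] at hab
      linarith
  · by_cases hb : b = 0
    · subst hb
      have := slant_addPoint_mem t q a ha
      rw [addPoint_zero]
      linarith
    · obtain ⟨a, rfl⟩ := Fin.exists_succ_eq.2 ha
      obtain ⟨b, rfl⟩ := Fin.exists_succ_eq.2 hb
      simpa only [slant_addPoint_succ] using hab

theorem rk_slant_addPoint {s t : ℝ} {p q : ℂ} (hp : slant s p ≤ -farDist k)
    (hq : farDist k ≤ slant t q) :
    rk (slant s ∘ addPoint (k := k) p) = finRotate (k + 1) * rk (slant t ∘ addPoint q) := by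
  have h0 := farDist_pos (k := k)
  refine rk_eq_finRotate_mul (injective_slant_addPoint (le_abs'.2 (.inl hp)))
    (injective_slant_addPoint (le_abs'.2 (.inr hq))) 0 (fun i hi => ?_) (fun i hi => ?_)
    fun i j hi hj h => ?_
  · have := slant_addPoint_mem s p i hi
    simp only [Function.comp_apply, addPoint_zero]
    linarith
  · have := slant_addPoint_mem t q i hi
    simp only [Function.comp_apply, addPoint_zero]
    linarith
  · obtain ⟨i, rfl⟩ := Fin.exists_succ_eq.2 hi
    obtain ⟨j, rfl⟩ := Fin.exists_succ_eq.2 hj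
    simpa only [Function.comp_apply, slant_addPoint_succ] using h

theorem farDist_le_norm {s : ℝ} (hs : s ∈ I) {p : ℂ} (hp : farDist k ≤ |slant s p|) :
    farDist k ≤ ‖p‖ := hp.trans (abs_slant_le hs p)

variable [NeZero k]

theorem trans_addPoint_eq {s t : I} {p q : ℂ} (hp : farDist k ≤ |slant t p|)
    (hpq : slant t p = slant t q) :
    trans (s, true) (t, false) (cfg (aff ∘ addPoint (k := k) p)) =
      trans (s, true) (t, false) (cfg (aff ∘ addPoint q)) := by
  let γ : ℝ → Fin (k + 1) → CP 1 := fun u => aff ∘ addPoint ((1 - u) • p + u • q)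
  have hγ : Continuous γ := by
    refine continuous_pi fun i => isOpenEmbedding_aff.continuous.comp ?_
    refine Fin.cases ?_ (fun j => ?_) i
    · simp only [addPoint_zero]
      fun_prop
    · simp only [addPoint, Fin.cons_succ]
      fun_prop
  have h (u : ℝ) : farDist k ≤ |slant t ((1 - u) • p + u • q)| := by
    rw [map_add, map_smul, map_smul, ← hpq, ← add_smul, sub_add_cancel, one_smul]
    exact hp
  have h0 : γ 0 = aff ∘ addPoint p := by simp [γ]
  have h1 : γ 1 = aff ∘ addPoint q := by simp [γ]
  rw [← h0, ← h1]
  exact trans_eq_of_curve hγ.continuousOn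
    (fun u _ => good_true_addPoint s (farDist_le_norm t.2 (h u)))
    fun u _ => good_false_addPoint (h u)

theorem permBraid_finRotate :
    permBraid (finRotate (k + 1)) * permBraid (finRotate (k + 1))⁻¹ = 1 := by
  let R := farDist k
  have hR : 0 < R := farDist_pos
  have hne : R ≤ |-R| := by rw [abs_neg]; exact le_abs_self R
  have hpos : R ≤ |R| := le_abs_self R
  have s0 (p : ℂ) : slant ((0 : I) : ℝ) p = p.re := by simp [slant_apply]
  have s1 (p : ℂ) : slant ((1 : I) : ℝ) p = p.im := by simp [slant_apply]
  have m0 {p : ℂ} (h : R ≤ |p.re|) : cfg (aff ∘ addPoint (k := k) p) ∈ chart (0, false) :=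
    (good_false_addPoint (by rwa [s0])).mem_chart
  have m1 {p : ℂ} (h : R ≤ |p.im|) : cfg (aff ∘ addPoint (k := k) p) ∈ chart (1, false) :=
    (good_false_addPoint (by rwa [s1])).mem_chart
  have mv {p : ℂ} (h : R ≤ |p.im|) : cfg (aff ∘ addPoint (k := k) p) ∈ chart (0, true) :=
    (good_true_addPoint 0 (farDist_le_norm (1 : I).2 (by rwa [s1]))).mem_chart
  have factor {p : ℂ} (h : R ≤ |p.re|) (h' : R ≤ |p.im|) :
      (trans (0, true) (0, false) (cfg (aff ∘ addPoint (k := k) p)))⁻¹ *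
        trans (0, true) (1, false) (cfg (aff ∘ addPoint (k := k) p)) =
      trans (0, false) (1, false) (cfg (aff ∘ addPoint p)) := by
    rw [trans_inv (mv h') (m0 h), trans_mul (m0 h) (mv h') (m1 h')]
  have std {p : ℂ} (h : R ≤ |p.re|) (h' : R ≤ |p.im|) :
      trans (0, false) (1, false) (cfg (aff ∘ addPoint (k := k) p)) =
        cmpLift permBraid (slant (0 : I) ∘ addPoint (k := k) p) (slant (1 : I) ∘ addPoint p) :=
    trans_eq_cmpLift zero_lt_one (injective_slant_addPoint (by rwa [s0]))
      (injective_slant_addPoint (by rwa [s1]))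
  have sw := factor (p := ⟨-R, -R⟩) hne hne
  have nw := factor (p := ⟨-R, R⟩) hne hpos
  have ne := factor (p := ⟨R, R⟩) hpos hpos
  have se := factor (p := ⟨R, -R⟩) hpos hne
  rw [std hne hne, cmpLift, rk_slant_addPoint_of_neg (s := (0 : I)) (t := (1 : I))
    (q := ⟨-R, -R⟩) (by rw [s0]) (by rw [s1]), mul_inv_cancel, isLift_permBraid.one,
    inv_mul_eq_one] at sw
  rw [std hpos hpos, cmpLift, rk_slant_addPoint_of_pos (s := (0 : I)) (t := (1 : I))
    (q := ⟨R, R⟩) (by rw [s0]) (by rw [s1]), mul_inv_cancel, isLift_permBraid.one,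
    inv_mul_eq_one] at ne
  rw [std hne hpos, cmpLift, rk_slant_addPoint (s := (0 : I)) (t := (1 : I))
    (q := ⟨-R, R⟩) (by rw [s0]) (by rw [s1]), mul_inv_cancel_right] at nw
  rw [std hpos hne, cmpLift, rk_slant_addPoint (s := (1 : I)) (t := (0 : I))
    (q := ⟨R, -R⟩) (by rw [s1]) (by rw [s0]), mul_inv_rev, mul_inv_cancel_left] at se
  rw [← nw, ← se,
    trans_addPoint_eq (t := 0) (p := ⟨-R, R⟩) (q := ⟨-R, -R⟩) (by rwa [s0]) (by rw [s0, s0]),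
    trans_addPoint_eq (t := 1) (p := ⟨-R, R⟩) (q := ⟨R, R⟩) (by rwa [s1]) (by rw [s1, s1]),
    trans_addPoint_eq (t := 0) (p := ⟨R, -R⟩) (q := ⟨R, R⟩) (by rwa [s0]) (by rw [s0, s0]),
    trans_addPoint_eq (t := 1) (p := ⟨R, -R⟩) (q := ⟨-R, -R⟩) (by rwa [s1]) (by rw [s1, s1]),
    sw, ne]
  group

theorem exists_braidHom : ∃ Φ : SphereBraid k →* FundamentalGroup (Conf k) (cover k).base,
    ∀ i, Φ (gen i) = permBraid (adjSwap i) := by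
  refine exists_hom isLift_permBraid.isArtin ?_
  have h1 := isLift_permBraid.prod_range le_rfl _ (val_finRotate (k := k))
  have h2 := isLift_permBraid.prod_range_reverse (Nat.zero_le k) _ (val_finRotate_inv (k := k))
  rw [List.drop_zero] at h2
  rw [← h1, ← h2]
  exact permBraid_finRotate

end SphereConf

end

section

open Set Topology unitInterval

namespace SphereConf

open ArtinLift

variable {k : ℕ}

theorem continuous_update_infc (x : Fin (k + 1) → CP 1) (κ : Fin (k + 1)) :
    Continuous fun u : ℝ => Function.update x κ (infc (u : ℂ)) :=
  continuous_const.update κ (isOpenEmbedding_infc.continuous.comp Complex.continuous_ofReal)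

variable [NeZero k] {s t : I} {c : Conf k} {x : Fin (k + 1) → CP 1}

/-! ### Generation -/

theorem exists_mem_chart_false (hx : Function.Injective x) (h : ∀ i, x i ≠ infc 0) :
    ∃ s : I, cfg x ∈ chart (s, false) := by
  obtain ⟨s, hs, h'⟩ := exists_slant_injOn univ (z := zc ∘ x) fun i _ j _ e => hx (by
    rw [← aff_zc (h i), ← aff_zc (h j)]; exact congrArg aff e)
  exact ⟨⟨s, hs⟩, (mem_chartW hx).2 ⟨h, injOn_univ.1 h'⟩⟩

theorem trans_false_false (hs : c ∈ chart (s, false)) (ht : c ∈ chart (t, false)) :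
    trans (s, false) (t, false) c ∈ Subgroup.closure (range (permBraid (k := k))) := by
  obtain ⟨x, hx, rfl⟩ := exists_cfg_eq c
  obtain ⟨h, hs'⟩ := (mem_chartW hx).1 hs
  obtain ⟨-, ht'⟩ := (mem_chartW hx).1 ht
  obtain ⟨z, rfl⟩ : ∃ z, x = aff ∘ z := ⟨zc ∘ x, by ext i; simp [aff_zc (h i)]⟩
  have e (r : ℝ) : slant r ∘ zc ∘ aff ∘ z = slant r ∘ z := by ext; simp
  rw [e] at hs' ht'
  rcases lt_trichotomy s t with h | rfl | h
  · rw [trans_eq_cmpLift h hs' ht']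
    exact Subgroup.subset_closure (mem_range_self _)
  · rw [trans_eq_one hs' hs' rfl]
    exact one_mem _
  · rw [← trans_inv ht hs, trans_eq_cmpLift h ht' hs']
    exact inv_mem (Subgroup.subset_closure (mem_range_self _))

theorem vtuple_ne_of_mem_chart {p : ℂ × (Fin k → ℂ)} (hp : Function.Injective (vtuple p))
    (h : cfg (vtuple p) ∈ chart (t, false)) : p.1 ≠ 0 := by
  intro h0
  refine ((mem_chartW hp).1 h).1 0 ?_
  rw [vtuple_zero, h0, zero_div]

theorem exists_mem_chart_vtuple {p : ℂ × (Fin k → ℂ)} (hp : Function.Injective (vtuple p))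
    (h : p.1 ≠ 0) : ∃ t : I, cfg (vtuple p) ∈ chart (t, false) := by
  refine exists_mem_chart_false hp fun i => ?_
  refine Fin.cases ?_ (fun j => ?_) i
  · rw [vtuple_zero, Ne, infc_eq_infc_zero, div_eq_zero_iff, not_or, Complex.ofReal_eq_zero]
    exact ⟨h, by positivity⟩
  · exact aff_ne_infc_zero _

theorem joinedIn_chart_true (hs : c ∈ chart (s, true)) (ht : c ∈ chart (t, false)) :
    JoinedIn (chart (s, true) ∩ ⋃ r : I, chart (r, false)) (cover k).base c := by
  obtain ⟨p, ⟨hp1, hp2⟩, rfl⟩ : c ∈ chartV s := hs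
  obtain ⟨q, ⟨hq1, hq2⟩, hq⟩ : (cover k).base ∈ chartV s := (cover k).base_mem (s, true)
  have hp0 : p.1 ≠ 0 := vtuple_ne_of_mem_chart (injective_vtuple hp1 hp2) ht
  have hq0 : q.1 ≠ 0 := vtuple_ne_of_mem_chart (t := 0) (injective_vtuple hq1 hq2) (by
    have := (cover k).base_mem (0, false)
    rw [← hq] at this
    exact this)
  rw [← hq]
  let γ : ℝ → ℂ × (Fin k → ℂ) := fun u =>
    (Complex.exp ((1 - u) • Complex.log q.1 + u • Complex.log p.1), (1 - u) • q.2 + u • p.2)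
  have hγ : Continuous γ := by fun_prop
  have h1 (u : ℝ) (hu : u ∈ I) : ‖(γ u).1‖ < 1 := by
    simp only [γ, Complex.norm_exp, Real.exp_lt_one_iff, Complex.add_re, Complex.smul_re,
      Complex.log_re, smul_eq_mul]
    have a := Real.log_neg (norm_pos_iff.2 hq0) hq1
    have b := Real.log_neg (norm_pos_iff.2 hp0) hp1
    obtain ⟨hu0, hu1⟩ := hu
    rcases hu0.eq_or_lt with rfl | hu0
    · simpa using a
    · nlinarith
  have h2 (u : ℝ) (hu : u ∈ I) : StrictMono (slant s ∘ (γ u).2) :=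
    convex_strictMono (s : ℝ) hq2 hp2 (sub_nonneg.2 hu.2) hu.1 (sub_add_cancel _ _)
  have e0 : γ 0 = q := by simp [γ, Complex.exp_log hq0]
  have e1 : γ 1 = p := by simp [γ, Complex.exp_log hp0]
  refine JoinedIn.ofLine (f := fun u => cfg (vtuple (γ u))) ?_ (by simp only [e0])
    (by simp only [e1]) ?_
  · exact continuousOn_cfg.comp (isOpenEmbedding_vtuple.continuous.comp hγ).continuousOn
      fun u hu => injective_vtuple (h1 u hu) (h2 u hu)
  · rintro _ ⟨u, hu, rfl⟩
    obtain ⟨r, hr⟩ := exists_mem_chart_vtuple (injective_vtuple (h1 u hu) (h2 u hu))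
      (Complex.exp_ne_zero _)
    exact ⟨⟨γ u, ⟨h1 u hu, h2 u hu⟩, rfl⟩, mem_iUnion.2 ⟨r, hr⟩⟩

theorem trans_true_false (hs : c ∈ chart (s, true)) (ht : c ∈ chart (t, false)) :
    trans (s, true) (t, false) c ∈ Subgroup.closure (range (permBraid (k := k))) := by
  have h := joinedIn_chart_true hs ht
  rw [trans_eq hs ht]
  refine (cover k).loop_mem_of_path _ {i | i.2 = false} (s, true) ?_ h.somePath
    (fun u => (h.somePath_mem u).1) (fun u => ?_) (i := (0, false)) (i' := (t, false))
    rfl rfl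
    ((cover k).base_mem _) ((cover k).base_mem _) hs ht ?_
  · rintro ⟨i, _⟩ rfl ⟨j, _⟩ rfl c hi hj
    rw [← trans_eq hi hj]
    exact trans_false_false hi hj
  · obtain ⟨r, hr⟩ := mem_iUnion.1 (h.somePath_mem u).2
    exact ⟨(r, false), rfl, hr⟩
  · rw [(cover k).loop_base]
    exact one_mem _

theorem trans_true_true (hs : c ∈ chart (s, true)) (ht : c ∈ chart (t, true)) :
    trans (s, true) (t, true) c ∈ Subgroup.closure (range (permBraid (k := k))) := by
  have finite {x : Fin (k + 1) → CP 1} (hx : Function.Injective x) (h : ∀ i, x i ≠ infc 0)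
      (hs : cfg x ∈ chart (s, true)) (ht : cfg x ∈ chart (t, true)) :
      trans (s, true) (t, true) (cfg x) ∈ Subgroup.closure (range (permBraid (k := k))) := by
    obtain ⟨r, hr⟩ := exists_mem_chart_false hx h
    rw [← trans_mul hs hr ht, ← trans_inv ht hr]
    exact mul_mem (trans_true_false hs hr) (inv_mem (trans_true_false ht hr))
  obtain ⟨x, hx, rfl⟩ := exists_cfg_eq c
  obtain ⟨κ, hκ⟩ := exists_good (T := {(s, true), (t, true)}) hx (by
    rintro i (rfl | rfl)
    exacts [hs, ht])
  have gs := hκ (s, true) (by simp)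
  have gt := hκ (t, true) (by simp)
  by_cases h0 : x κ = infc 0
  · have hγ := continuous_update_infc x κ
    have e0 : Function.update x κ (infc ((0 : ℝ) : ℂ)) = x := by
      rw [Complex.ofReal_zero, ← h0, Function.update_eq_self]
    have hev := (hγ.tendsto' 0 x e0).eventually (gs.eventually.and gt.eventually)
    obtain ⟨ε, hε, hball⟩ := Metric.eventually_nhds_iff.1 hev
    let γ : ℝ → Fin (k + 1) → CP 1 := fun u => Function.update x κ (infc ((ε / 2 * u : ℝ) : ℂ))
    have hg (u : ℝ) (hu : u ∈ I) : Good κ (s, true) (γ u) ∧ Good κ (t, true) (γ u) := by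
      refine hball ?_
      rw [Real.dist_eq, sub_zero, abs_of_nonneg (mul_nonneg (by positivity) hu.1)]
      nlinarith [hu.2]
    have hγ' : Continuous γ := hγ.comp (continuous_const.mul continuous_id)
    have e0' : γ 0 = x := by simp only [γ, mul_zero]; exact e0
    have key := trans_eq_of_curve hγ'.continuousOn (fun u hu => (hg u hu).1)
      fun u hu => (hg u hu).2
    obtain ⟨g1, g2⟩ := hg 1 ⟨zero_le_one, le_rfl⟩
    rw [e0'] at key
    rw [key]
    refine finite g1.injective (fun i => ?_) g1.mem_chart g2.mem_chart
    by_cases hi : i = κ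
    · subst hi
      simp only [γ, Function.update_self, Ne, infc_eq_infc_zero, Complex.ofReal_eq_zero]
      positivity
    · exact g1.1.ne_of_ne hi
  · refine finite hx (fun i => ?_) hs ht
    by_cases hi : i = κ
    · rwa [hi]
    · exact gs.1.ne_of_ne hi

theorem closure_permBraid : Subgroup.closure (range (permBraid (k := k))) = ⊤ := by
  refine (cover k).eq_top_of_loop_mem _ fun i j c hi hj => ?_
  rw [← trans_eq hi hj]
  obtain ⟨s, _ | _⟩ := i <;> obtain ⟨t, _ | _⟩ := j
  · exact trans_false_false hi hj
  · rw [← trans_inv hj hi]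
    exact inv_mem (trans_true_false hj hi)
  · exact trans_true_false hi hj
  · exact trans_true_true hi hj

theorem exists_mulEquiv :
    Nonempty (FundamentalGroup (Conf k) (cover k).base ≃* SphereBraid k) := by
  obtain ⟨Φ, hΦ⟩ := exists_braidHom (k := k)
  obtain ⟨L, hL⟩ := exists_isLift (isArtin_gen (k := k))
  have hΦL : (fun w => Φ (L w)) = permBraid := by
    have := hL.map Φ
    simp only [hΦ] at this
    exact this.unique isLift_permBraid
  have hsurj : Function.Surjective Φ := by
    rw [← MonoidHom.range_eq_top, eq_top_iff, ← closure_permBraid, Subgroup.closure_le]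
    rintro _ ⟨w, rfl⟩
    exact ⟨L w, congrFun hΦL w⟩
  obtain ⟨E, T, e, he, hT⟩ := exists_braid_monodromy hL prod_gen
  have hgen (i : Fin k) (h : SphereBraid k) : T (Φ (gen i)) (e h) = e (gen i * h) := by
    have h0 : slant ((0 : I) : ℝ) ∘ line 0 1 (stdPos ∘ adjSwap i) stdPos = stdPos ∘ adjSwap i :=
      slant_line_left _ _
    have h1 : slant ((1 : I) : ℝ) ∘ line 0 1 (stdPos ∘ adjSwap i) stdPos = stdPos :=
      slant_line_right one_pos _ _
    have inj := (strictMono_stdPos (k := k)).injective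
    have g0 : Good 0 (0, false) (aff ∘ line 0 1 (stdPos ∘ adjSwap i) stdPos) :=
      good_aff (by rw [h0]; exact inj.comp (adjSwap i).injective)
    have g1 : Good 0 (1, false) (aff ∘ line 0 1 (stdPos ∘ adjSwap i) stdPos) :=
      good_aff (by rw [h1]; exact inj)
    rw [hΦ, permBraid, stdTrans, trans_eq g0.mem_chart g1.mem_chart]
    refine (hT _ _ _ _ _ h).trans ?_
    rw [braidCocycle_cfg g0 g1, coc_false, cmpFam, if_pos (by simp), ord_aff, ord_aff, h0, h1,
      cmpLift, rk_stdPos_comp, rk_of_strictMono strictMono_stdPos, inv_one, mul_one, hL.apply_adjSwap]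
  have hall (g : SphereBraid k) : ∀ h, T (Φ g) (e h) = e (g * h) := by
    have hg : g ∈ Subgroup.closure
        (range (PresentedGroup.of (rels := ArtinRels k ∪ {sphereWord k}))) := by
      rw [PresentedGroup.closure_range_of]; trivial
    induction hg using Subgroup.closure_induction with
    | mem g hg =>
      obtain ⟨i, rfl⟩ := hg
      exact hgen i
    | one =>
      intro h
      rw [map_one, map_one, Equiv.Perm.one_apply, one_mul]
    | mul a b _ _ ha hb =>
      intro h
      rw [map_mul, map_mul, Equiv.Perm.mul_apply, hb, ha, mul_assoc]
    | inv a _ ha =>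
      intro h
      rw [map_inv, map_inv, Equiv.Perm.inv_eq_iff_eq, ha, mul_inv_cancel_left]
  have hinj : Function.Injective Φ := by
    rw [injective_iff_map_eq_one]
    intro g hg
    have := hall g 1
    rw [hg, map_one, Equiv.Perm.one_apply, mul_one] at this
    exact (he this).symm
  exact ⟨(MulEquiv.ofBijective Φ ⟨hinj, hsurj⟩).symm⟩

theorem joined_base (c : Conf k) : Joined (cover k).base c := by
  obtain ⟨i, hi⟩ := exists_mem_chart c
  have := (isOpen_simplyConnected_chart (k := k) i).2
  have h : IsPathConnected (chart (k := k) i) :=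
    isPathConnected_iff_pathConnectedSpace.2 inferInstance
  exact (h.joinedIn _ (base_mem_chart i) _ hi).joined

instance : PathConnectedSpace (Conf k) where
  nonempty := ⟨(cover k).base⟩
  joined x y := (joined_base x).symm.trans (joined_base y)

end SphereConf

end

/-- For `k ≥ 2`, `π₁(C_{k+1}^{1,1})` is presented by generators `σ_1, …, σ_k` subject to
the Artin relations and `σ_1⋯σ_{k-1}σ_k²σ_{k-1}⋯σ_1 = 1`. -/
theorem pi1_Cconf_one_one (k : ℕ) (hk : 2 ≤ k) (x : Cconf (k + 1) 1 1) :
    Nonempty (FundamentalGroup (Cconf (k + 1) 1 1) x ≃*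
      PresentedGroup (ArtinRels k ∪ {sphereWord k})) := by
  have : NeZero k := ⟨by omega⟩
  obtain ⟨Φ⟩ := SphereConf.exists_mulEquiv (k := k)
  exact ⟨(FundamentalGroup.fundamentalGroupMulEquivOfPathConnected _ _).trans Φ⟩
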